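/- arXiv:2005.06673 — 5 statements merged into one kernel-verified Lean document; each statement's English description precedes it below -/
import Mathlib

section
/- Let X be a standard Borel space, ζ a Borel probability measure on X, and let Y¹ and Y² be nonempty compact metric spaces. Let μ and ν be information structures on X × Y¹ × Y², each satisfying Assumption 2.1. Then μ is better for the maximizer than ν — i.e., V*(μ) ≥ V*(ν) for every game in the class G̃ (nonempty compact metric action spaces U¹, U² and bounded jointly measurable cost c : X × U¹ × U² → ℝ continuous in (u¹,u²) for every x) — if and only if there exist Markov kernels κ¹ from Y¹ to Y¹ and κ² from Y² to Y² such that κ¹ν = κ²μ as measures on X × Y¹ × Y². -/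
open MeasureTheory ProbabilityTheory

/-- The value `V*(P)` of the zero-sum game with information structure `P` and cost `c`:
the infimum over the minimizer's randomized policies (Markov kernels from `Y₁` to `U₁`) of
the supremum over the maximizer's randomized policies (Markov kernels from `Y₂` to `U₂`)
of the expected cost. -/
noncomputable def gameValue {X Y₁ Y₂ U₁ U₂ : Type*}
    [MeasurableSpace X] [MeasurableSpace Y₁] [MeasurableSpace Y₂]
    [MeasurableSpace U₁] [MeasurableSpace U₂]
    (P : Measure (X × Y₁ × Y₂)) (c : X → U₁ → U₂ → ℝ) : ℝ :=
  ⨅ γ₁ : {κ : Kernel Y₁ U₁ // IsMarkovKernel κ},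
    ⨆ γ₂ : {κ : Kernel Y₂ U₂ // IsMarkovKernel κ},
      ∫ p : X × Y₁ × Y₂, ∫ u₁, ∫ u₂, c p.1 u₁ u₂ ∂(γ₂.1 p.2.2) ∂(γ₁.1 p.2.1) ∂P

open scoped BoundedContinuousFunction

lemma integrable_of_measurable_of_abs_le {α : Type*} [MeasurableSpace α] {m : Measure α}
    [IsFiniteMeasure m] {f : α → ℝ} {M : ℝ} (hf : Measurable f) (hM : ∀ a, |f a| ≤ M) :
    Integrable f m :=
  .of_bound hf.aestronglyMeasurable M (.of_forall hM)

lemma abs_integral_le_of_abs_le {α : Type*} [MeasurableSpace α] {m : Measure α}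
    [IsProbabilityMeasure m] {f : α → ℝ} {M : ℝ} (hM : ∀ a, |f a| ≤ M) :
    |∫ a, f a ∂m| ≤ M := by
  simpa using norm_integral_le_of_norm_le_const (μ := m) (f := f) (.of_forall hM)

lemma measurable_integral_kernel {α β γ : Type*} [MeasurableSpace α] [MeasurableSpace β]
    [MeasurableSpace γ] (κ : Kernel β γ) [IsSFiniteKernel κ] {f : α → β → γ → ℝ}
    (hf : Measurable fun p : α × β × γ => f p.1 p.2.1 p.2.2) :
    Measurable fun p : α × β => ∫ c, f p.1 p.2 c ∂κ p.2 := by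
  have h : StronglyMeasurable fun q : (α × β) × γ => f q.1.1 q.1.2 q.2 :=
    (hf.comp (by fun_prop : Measurable fun q : (α × β) × γ =>
      (q.1.1, q.1.2, q.2))).stronglyMeasurable
  exact (h.integral_kernel_prod_right' (κ := κ.comap Prod.snd measurable_snd)).measurable

section Garbling

variable {X Y₁ Y₂ : Type*} [MeasurableSpace X] [MeasurableSpace Y₁] [MeasurableSpace Y₂]

/-- The information structure obtained from `P` by garbling player 1's measurement by `κ`. -/
noncomputable def garbleFirst (P : Measure (X × Y₁ × Y₂)) (κ : Kernel Y₁ Y₁) :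
    Measure (X × Y₁ × Y₂) :=
  (P ⊗ₘ κ.comap (fun p : X × Y₁ × Y₂ => p.2.1) (by fun_prop)).map
    fun q => (q.1.1, q.2, q.1.2.2)

/-- The information structure obtained from `P` by garbling player 2's measurement by `κ`. -/
noncomputable def garbleSecond (P : Measure (X × Y₁ × Y₂)) (κ : Kernel Y₂ Y₂) :
    Measure (X × Y₁ × Y₂) :=
  (P ⊗ₘ κ.comap (fun p : X × Y₁ × Y₂ => p.2.2) (by fun_prop)).map
    fun q => (q.1.1, q.1.2.1, q.2)

variable (P : Measure (X × Y₁ × Y₂)) [IsProbabilityMeasure P]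

instance (κ : Kernel Y₁ Y₁) [IsMarkovKernel κ] : IsProbabilityMeasure (garbleFirst P κ) :=
  Measure.isProbabilityMeasure_map (by fun_prop)

instance (κ : Kernel Y₂ Y₂) [IsMarkovKernel κ] : IsProbabilityMeasure (garbleSecond P κ) :=
  Measure.isProbabilityMeasure_map (by fun_prop)

lemma garbleFirst_prod (κ : Kernel Y₁ Y₁) [IsMarkovKernel κ] {A : Set X} {B : Set Y₁} {C : Set Y₂}
    (hA : MeasurableSet A) (hB : MeasurableSet B) (hC : MeasurableSet C) :
    garbleFirst P κ (A ×ˢ B ×ˢ C) = ∫⁻ p in A ×ˢ ((Set.univ : Set Y₁) ×ˢ C), κ p.2.1 B ∂P := by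
  rw [garbleFirst, Measure.map_apply (by fun_prop) (hA.prod (hB.prod hC))]
  have : (fun q : (X × Y₁ × Y₂) × Y₁ => (q.1.1, q.2, q.1.2.2)) ⁻¹' (A ×ˢ B ×ˢ C)
      = (A ×ˢ ((Set.univ : Set Y₁) ×ˢ C)) ×ˢ B := by
    ext q; simp; tauto
  rw [this, Measure.compProd_apply_prod (hA.prod (.prod .univ hC)) hB]
  rfl

lemma garbleSecond_prod (κ : Kernel Y₂ Y₂) [IsMarkovKernel κ] {A : Set X} {B : Set Y₁} {C : Set Y₂}
    (hA : MeasurableSet A) (hB : MeasurableSet B) (hC : MeasurableSet C) :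
    garbleSecond P κ (A ×ˢ B ×ˢ C) = ∫⁻ p in A ×ˢ (B ×ˢ (Set.univ : Set Y₂)), κ p.2.2 C ∂P := by
  rw [garbleSecond, Measure.map_apply (by fun_prop) (hA.prod (hB.prod hC))]
  have : (fun q : (X × Y₁ × Y₂) × Y₂ => (q.1.1, q.1.2.1, q.2)) ⁻¹' (A ×ˢ B ×ˢ C)
      = (A ×ˢ (B ×ˢ (Set.univ : Set Y₂))) ×ˢ C := by
    ext q; simp; tauto
  rw [this, Measure.compProd_apply_prod (hA.prod (hB.prod .univ)) hC]
  rfl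

variable {F : X × Y₁ × Y₂ → ℝ} {M : ℝ}

lemma integral_garbleFirst (κ : Kernel Y₁ Y₁) [IsMarkovKernel κ] (hF : Measurable F)
    (hM : ∀ p, |F p| ≤ M) :
    ∫ p, F p ∂garbleFirst P κ = ∫ p, ∫ y, F (p.1, y, p.2.2) ∂κ p.2.1 ∂P := by
  rw [garbleFirst, integral_map (by fun_prop) hF.aestronglyMeasurable,
    Measure.integral_compProd]
  · rfl
  · exact integrable_of_measurable_of_abs_le (hF.comp (by fun_prop)) fun _ => hM _

lemma integral_garbleSecond (κ : Kernel Y₂ Y₂) [IsMarkovKernel κ] (hF : Measurable F)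
    (hM : ∀ p, |F p| ≤ M) :
    ∫ p, F p ∂garbleSecond P κ = ∫ p, ∫ y, F (p.1, p.2.1, y) ∂κ p.2.2 ∂P := by
  rw [garbleSecond, integral_map (by fun_prop) hF.aestronglyMeasurable,
    Measure.integral_compProd]
  · rfl
  · exact integrable_of_measurable_of_abs_le (hF.comp (by fun_prop)) fun _ => hM _

variable {U₁ U₂ : Type*} [MeasurableSpace U₁] [MeasurableSpace U₂] {c : X → U₁ → U₂ → ℝ}

lemma measurable_integral_integral_cost (γ₁ : Kernel Y₁ U₁) (γ₂ : Kernel Y₂ U₂)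
    [IsMarkovKernel γ₁] [IsMarkovKernel γ₂]
    (hc : Measurable fun p : X × U₁ × U₂ => c p.1 p.2.1 p.2.2) :
    Measurable fun p : X × Y₁ × Y₂ => ∫ u₁, ∫ u₂, c p.1 u₁ u₂ ∂γ₂ p.2.2 ∂γ₁ p.2.1 := by
  have h₂ : Measurable fun q : (X × U₁) × Y₂ => ∫ u₂, c q.1.1 q.1.2 u₂ ∂γ₂ q.2 :=
    measurable_integral_kernel γ₂ (f := fun (a : X × U₁) (_ : Y₂) u => c a.1 a.2 u)
      (hc.comp (by fun_prop : Measurable fun p : (X × U₁) × Y₂ × U₂ => (p.1.1, p.1.2, p.2.2)))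
  have h₁ := measurable_integral_kernel γ₁
    (f := fun (a : X × Y₂) (_ : Y₁) u => ∫ u₂, c a.1 u u₂ ∂γ₂ a.2)
    (h₂.comp (by fun_prop : Measurable fun p : (X × Y₂) × Y₁ × U₁ => ((p.1.1, p.2.2), p.1.2)))
  exact h₁.comp (by fun_prop : Measurable fun p : X × Y₁ × Y₂ => ((p.1, p.2.2), p.2.1))

variable (hc : Measurable fun p : X × U₁ × U₂ => c p.1 p.2.1 p.2.2)
  (hM : ∀ x u₁ u₂, |c x u₁ u₂| ≤ M)
include hc hM

lemma integral_comp_first_eq_integral_garbleFirst (κ : Kernel Y₁ Y₁) (γ₁ : Kernel Y₁ U₁)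
    (γ₂ : Kernel Y₂ U₂) [IsMarkovKernel κ] [IsMarkovKernel γ₁] [IsMarkovKernel γ₂] :
    ∫ p, ∫ u₁, ∫ u₂, c p.1 u₁ u₂ ∂γ₂ p.2.2 ∂(γ₁ ∘ₖ κ) p.2.1 ∂P =
      ∫ p, ∫ u₁, ∫ u₂, c p.1 u₁ u₂ ∂γ₂ p.2.2 ∂γ₁ p.2.1 ∂garbleFirst P κ := by
  rw [integral_garbleFirst P κ (measurable_integral_integral_cost γ₁ γ₂ hc)
    fun p => abs_integral_le_of_abs_le fun _ => abs_integral_le_of_abs_le fun _ => hM _ _ _]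
  refine integral_congr_ae (.of_forall fun p => ?_)
  refine Kernel.integral_comp (integrable_of_measurable_of_abs_le (M := M) ?_
    fun _ => abs_integral_le_of_abs_le fun _ => hM _ _ _)
  have h : StronglyMeasurable fun q : U₁ × U₂ => c p.1 q.1 q.2 :=
    (hc.comp (by fun_prop : Measurable fun q : U₁ × U₂ => (p.1, q.1, q.2))).stronglyMeasurable
  exact h.integral_prod_right'.measurable

lemma integral_comp_second_eq_integral_garbleSecond (κ : Kernel Y₂ Y₂) (γ₁ : Kernel Y₁ U₁)
    (γ₂ : Kernel Y₂ U₂) [IsMarkovKernel κ] [IsMarkovKernel γ₁] [IsMarkovKernel γ₂] :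
    ∫ p, ∫ u₁, ∫ u₂, c p.1 u₁ u₂ ∂(γ₂ ∘ₖ κ) p.2.2 ∂γ₁ p.2.1 ∂P =
      ∫ p, ∫ u₁, ∫ u₂, c p.1 u₁ u₂ ∂γ₂ p.2.2 ∂γ₁ p.2.1 ∂garbleSecond P κ := by
  rw [integral_garbleSecond P κ (measurable_integral_integral_cost γ₁ γ₂ hc)
    fun p => abs_integral_le_of_abs_le fun _ => abs_integral_le_of_abs_le fun _ => hM _ _ _]
  refine integral_congr_ae (.of_forall fun p => ?_)
  have hcx : Measurable fun q : U₁ × U₂ => c p.1 q.1 q.2 :=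
    hc.comp (by fun_prop : Measurable fun q : U₁ × U₂ => (p.1, q.1, q.2))
  have h₂ : ∀ u₁, ∫ u₂, c p.1 u₁ u₂ ∂(γ₂ ∘ₖ κ) p.2.2 =
      ∫ y, ∫ u₂, c p.1 u₁ u₂ ∂γ₂ y ∂κ p.2.2 := fun u₁ =>
    Kernel.integral_comp (integrable_of_measurable_of_abs_le (M := M)
      (hcx.comp (by fun_prop : Measurable fun u₂ : U₂ => (u₁, u₂))) fun _ => hM _ _ _)
  simp only [h₂]
  refine integral_integral_swap (integrable_of_measurable_of_abs_le (M := M) ?_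
    fun _ => abs_integral_le_of_abs_le fun _ => hM _ _ _)
  exact measurable_integral_kernel γ₂ (f := fun (u : U₁) (_ : Y₂) v => c p.1 u v)
    (hcx.comp (by fun_prop : Measurable fun q : U₁ × Y₂ × U₂ => (q.1, q.2.2)))

end Garbling

section GameValue

variable {X Y₁ Y₂ U₁ U₂ : Type*} [MeasurableSpace X] [MeasurableSpace Y₁] [MeasurableSpace Y₂]
  [MeasurableSpace U₁] [MeasurableSpace U₂] (P : Measure (X × Y₁ × Y₂)) [IsProbabilityMeasure P]
  {c : X → U₁ → U₂ → ℝ} {M : ℝ} (hM : ∀ x u₁ u₂, |c x u₁ u₂| ≤ M)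

instance nonempty_markovKernel {α β : Type*} [MeasurableSpace α] [MeasurableSpace β] [Nonempty β] :
    Nonempty {κ : Kernel α β // IsMarkovKernel κ} :=
  ⟨⟨Kernel.const α (Measure.dirac (Classical.arbitrary β)), inferInstance⟩⟩

include hM

lemma abs_expectedCost_le (γ₁ : {κ : Kernel Y₁ U₁ // IsMarkovKernel κ})
    (γ₂ : {κ : Kernel Y₂ U₂ // IsMarkovKernel κ}) :
    |∫ p, ∫ u₁, ∫ u₂, c p.1 u₁ u₂ ∂γ₂.1 p.2.2 ∂γ₁.1 p.2.1 ∂P| ≤ M := by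
  have := γ₁.2
  have := γ₂.2
  exact abs_integral_le_of_abs_le fun _ => abs_integral_le_of_abs_le fun _ =>
    abs_integral_le_of_abs_le fun _ => hM _ _ _

lemma bddAbove_range_expectedCost (γ₁ : {κ : Kernel Y₁ U₁ // IsMarkovKernel κ}) :
    BddAbove (Set.range fun γ₂ : {κ : Kernel Y₂ U₂ // IsMarkovKernel κ} =>
      ∫ p, ∫ u₁, ∫ u₂, c p.1 u₁ u₂ ∂γ₂.1 p.2.2 ∂γ₁.1 p.2.1 ∂P) :=
  ⟨M, by rintro _ ⟨γ₂, rfl⟩; exact (abs_le.1 (abs_expectedCost_le P hM γ₁ γ₂)).2⟩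

variable [Nonempty U₂]

lemma bddBelow_range_iSup_expectedCost :
    BddBelow (Set.range fun γ₁ : {κ : Kernel Y₁ U₁ // IsMarkovKernel κ} =>
      ⨆ γ₂ : {κ : Kernel Y₂ U₂ // IsMarkovKernel κ},
        ∫ p, ∫ u₁, ∫ u₂, c p.1 u₁ u₂ ∂γ₂.1 p.2.2 ∂γ₁.1 p.2.1 ∂P) := by
  refine ⟨-M, ?_⟩
  rintro _ ⟨γ₁, rfl⟩
  exact le_ciSup_of_le (bddAbove_range_expectedCost P hM γ₁) (Classical.arbitrary _)
    (abs_le.1 (abs_expectedCost_le P hM γ₁ _)).1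

lemma gameValue_le_of_forall_le (γ₁ : Kernel Y₁ U₁) [h₁ : IsMarkovKernel γ₁] {r : ℝ}
    (h : ∀ γ₂ : Kernel Y₂ U₂, IsMarkovKernel γ₂ →
      ∫ p, ∫ u₁, ∫ u₂, c p.1 u₁ u₂ ∂γ₂ p.2.2 ∂γ₁ p.2.1 ∂P ≤ r) :
    gameValue P c ≤ r :=
  ciInf_le_of_le (bddBelow_range_iSup_expectedCost P hM) ⟨γ₁, h₁⟩
    (ciSup_le fun γ₂ => h γ₂.1 γ₂.2)

omit [Nonempty U₂] in
lemma le_gameValue_of_forall_exists_le [Nonempty U₁] {r : ℝ}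
    (h : ∀ γ₁ : Kernel Y₁ U₁, IsMarkovKernel γ₁ → ∃ γ₂ : Kernel Y₂ U₂, IsMarkovKernel γ₂ ∧
      r ≤ ∫ p, ∫ u₁, ∫ u₂, c p.1 u₁ u₂ ∂γ₂ p.2.2 ∂γ₁ p.2.1 ∂P) :
    r ≤ gameValue P c := by
  refine le_ciInf fun γ₁ => ?_
  obtain ⟨γ₂, h₂, hr⟩ := h γ₁.1 γ₁.2
  exact le_ciSup_of_le (bddAbove_range_expectedCost P hM γ₁) ⟨γ₂, h₂⟩ hr

omit [IsProbabilityMeasure P] in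
/-- Garbling the minimizer in `ν` and the maximizer in `μ` to the same information structure
shows that `μ` is better for the maximizer. -/
lemma gameValue_le_gameValue_of_garble_eq [Nonempty U₁]
    {μ ν : Measure (X × Y₁ × Y₂)} [IsProbabilityMeasure μ] [IsProbabilityMeasure ν]
    (hc : Measurable fun p : X × U₁ × U₂ => c p.1 p.2.1 p.2.2)
    (κ₁ : Kernel Y₁ Y₁) (κ₂ : Kernel Y₂ Y₂) [IsMarkovKernel κ₁] [IsMarkovKernel κ₂]
    (h : garbleFirst ν κ₁ = garbleSecond μ κ₂) : gameValue ν c ≤ gameValue μ c := by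
  refine le_ciInf fun γ₁ => ?_
  have h₁ := γ₁.2
  refine gameValue_le_of_forall_le ν hM (γ₁.1 ∘ₖ κ₁) fun γ₂ h₂ => ?_
  refine le_ciSup_of_le (bddAbove_range_expectedCost μ hM γ₁) ⟨γ₂ ∘ₖ κ₂, inferInstance⟩ ?_
  rw [integral_comp_first_eq_integral_garbleFirst ν hc hM,
    integral_comp_second_eq_integral_garbleSecond μ hc hM, h]

omit hM in
/-- If the game with actions relabelled from `f` is better for the maximizer under `μ`, some
garblings of `ν` and `μ` violate strict separation by `f`. -/
lemma exists_integral_le_of_gameValue_le [Nonempty Y₁] [Nonempty Y₂]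
    {μ ν : Measure (X × Y₁ × Y₂)} [IsProbabilityMeasure μ] [IsProbabilityMeasure ν]
    {f : X → Y₁ → Y₂ → ℝ} (hM : ∀ x y₁ y₂, |f x y₁ y₂| ≤ M)
    (hf : Measurable fun p : X × Y₁ × Y₂ => f p.1 p.2.1 p.2.2)
    (e₁ : Y₁ ≃ᵐ U₁) (e₂ : Y₂ ≃ᵐ U₂)
    (h : gameValue ν (fun x u₁ u₂ => f x (e₁.symm u₁) (e₂.symm u₂)) ≤
      gameValue μ (fun x u₁ u₂ => f x (e₁.symm u₁) (e₂.symm u₂))) {δ : ℝ} (hδ : 0 < δ) :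
    ∃ (κ₁ : Kernel Y₁ Y₁) (κ₂ : Kernel Y₂ Y₂), IsMarkovKernel κ₁ ∧ IsMarkovKernel κ₂ ∧
      ∫ p, ∫ y, f p.1 y p.2.2 ∂κ₁ p.2.1 ∂ν ≤ ∫ p, ∫ y, f p.1 p.2.1 y ∂κ₂ p.2.2 ∂μ + δ := by
  by_contra! H
  have : Nonempty U₁ := e₁.symm.nonempty
  set S := ⨆ κ₂ : {κ : Kernel Y₂ Y₂ // IsMarkovKernel κ}, ∫ p, ∫ y, f p.1 p.2.1 y ∂κ₂.1 p.2.2 ∂μ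
  have hbdd : BddAbove (Set.range fun κ₂ : {κ : Kernel Y₂ Y₂ // IsMarkovKernel κ} =>
      ∫ p, ∫ y, f p.1 p.2.1 y ∂κ₂.1 p.2.2 ∂μ) := by
    refine ⟨M, ?_⟩
    rintro _ ⟨κ, rfl⟩
    have := κ.2
    exact (abs_le.1 (abs_integral_le_of_abs_le fun _ => abs_integral_le_of_abs_le fun _ =>
      hM _ _ _)).2
  have hfx₁ : ∀ x y, Measurable fun z => f x z y := fun x y =>
    hf.comp (by fun_prop : Measurable fun z : Y₁ => (x, z, y))
  have hfx₂ : ∀ x y, Measurable fun z => f x y z := fun x y =>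
    hf.comp (by fun_prop : Measurable fun z : Y₂ => (x, y, z))
  have hν : S + δ ≤ gameValue ν (fun x u₁ u₂ => f x (e₁.symm u₁) (e₂.symm u₂)) := by
    refine le_gameValue_of_forall_exists_le ν (M := M) (fun _ _ _ => hM _ _ _) fun γ₁ h₁ =>
      ⟨Kernel.deterministic e₂ e₂.measurable, inferInstance, ?_⟩
    have hγ : ∫ p, ∫ u₁, ∫ u₂, f p.1 (e₁.symm u₁) (e₂.symm u₂)
          ∂Kernel.deterministic e₂ e₂.measurable p.2.2 ∂γ₁ p.2.1 ∂ν =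
        ∫ p, ∫ y, f p.1 y p.2.2 ∂(γ₁.map e₁.symm) p.2.1 ∂ν := by
      refine integral_congr_ae (.of_forall fun p => ?_)
      dsimp only
      rw [Kernel.map_apply _ e₁.symm.measurable,
        integral_map e₁.symm.measurable.aemeasurable (hfx₁ _ _).aestronglyMeasurable]
      refine integral_congr_ae (.of_forall fun u₁ => ?_)
      dsimp only
      rw [Kernel.integral_deterministic' (f := fun u₂ => f p.1 (e₁.symm u₁) (e₂.symm u₂))
        e₂.measurable ((hfx₂ _ _).comp e₂.symm.measurable).stronglyMeasurable]
      simp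
    rw [hγ, ← le_sub_iff_add_le]
    have : IsMarkovKernel (γ₁.map e₁.symm) := Kernel.IsMarkovKernel.map γ₁ e₁.symm.measurable
    refine ciSup_le fun κ₂ => ?_
    have := H (γ₁.map e₁.symm) κ₂.1 this κ₂.2
    linarith
  have hμ : gameValue μ (fun x u₁ u₂ => f x (e₁.symm u₁) (e₂.symm u₂)) ≤ S := by
    refine gameValue_le_of_forall_le μ (M := M) (fun _ _ _ => hM _ _ _)
      (Kernel.deterministic e₁ e₁.measurable) fun γ₂ h₂ => ?_
    have : IsMarkovKernel (γ₂.map e₂.symm) := Kernel.IsMarkovKernel.map γ₂ e₂.symm.measurable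
    refine le_ciSup_of_le hbdd ⟨γ₂.map e₂.symm, this⟩ (le_of_eq ?_)
    refine integral_congr_ae (.of_forall fun p => ?_)
    have hm : StronglyMeasurable fun q : U₁ × U₂ => f p.1 (e₁.symm q.1) (e₂.symm q.2) :=
      (hf.comp (by fun_prop : Measurable fun q : U₁ × U₂ =>
        (p.1, e₁.symm q.1, e₂.symm q.2))).stronglyMeasurable
    dsimp only
    rw [Kernel.integral_deterministic' e₁.measurable hm.integral_prod_right',
      Kernel.map_apply _ e₂.symm.measurable,
      integral_map e₂.symm.measurable.aemeasurable (hfx₂ _ _).aestronglyMeasurable]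
    simp
  linarith

end GameValue

section Compactness

/-- Against probability measures with a fixed first marginal, test functions that are merely
integrable in the first variable define continuous functionals. -/
lemma continuousOn_integral_mul_of_fst_eq {Y Z : Type*} [TopologicalSpace Y] [NormalSpace Y]
    [MeasurableSpace Y] [BorelSpace Y] [TopologicalSpace Z] [MeasurableSpace Z] [OpensMeasurableSpace Z]
    [OpensMeasurableSpace (Y × Z)]
    (m : Measure Y) [m.WeaklyRegular] {w : Y → ℝ} (hw : Integrable w m) (φ : Z →ᵇ ℝ) :
    ContinuousOn (fun q : ProbabilityMeasure (Y × Z) => ∫ p, w p.1 * φ p.2 ∂(q : Measure (Y × Z)))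
      {q | (q : Measure (Y × Z)).fst = m} := by
  refine continuousOn_of_uniform_approx_of_continuousOn fun u hu => ?_
  obtain ⟨ε, hε, hεu⟩ := Metric.mem_uniformity_dist.1 hu
  have hpos : 0 < ‖φ‖ + 1 := by positivity
  obtain ⟨g, hg, hgi⟩ := hw.exists_boundedContinuous_integral_sub_le
    (show 0 < ε / 2 / (‖φ‖ + 1) by positivity)
  refine ⟨fun q => ∫ p, g p.1 * φ p.2 ∂(q : Measure (Y × Z)), ?_, fun q hq => hεu ?_⟩
  · exact (ProbabilityMeasure.continuous_integral_boundedContinuousFunction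
      (g.compContinuous ⟨Prod.fst, continuous_fst⟩ *
        φ.compContinuous ⟨Prod.snd, continuous_snd⟩)).continuousOn
  · have hq' : (q : Measure (Y × Z)).map Prod.fst = m := hq
    have hint : ∀ v : Y → ℝ, Integrable v m →
        Integrable (fun p : Y × Z => v p.1 * φ p.2) (q : Measure (Y × Z)) := fun v hv => by
      rw [← hq'] at hv
      exact (hv.comp_measurable measurable_fst).mul_bdd (c := ‖φ‖)
        (φ.continuous.measurable.comp measurable_snd).aestronglyMeasurable
        (.of_forall fun p => φ.norm_coe_le_norm _)
    have hd : Integrable (fun y => ‖w y - g y‖) m := (hw.sub hgi).norm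
    have hmap : ∫ p, ‖w p.1 - g p.1‖ ∂(q : Measure (Y × Z)) = ∫ y, ‖w y - g y‖ ∂m := by
      rw [← hq'] at hd ⊢
      rw [integral_map measurable_fst.aemeasurable hd.aestronglyMeasurable]
    rw [dist_eq_norm, ← integral_sub (hint w hw) (hint g hgi)]
    calc ‖∫ p, (w p.1 * φ p.2 - g p.1 * φ p.2) ∂(q : Measure (Y × Z))‖
        ≤ ∫ p, ‖w p.1 - g p.1‖ * (‖φ‖ + 1) ∂(q : Measure (Y × Z)) := by
          rw [← hq'] at hd
          refine norm_integral_le_of_norm_le ((hd.comp_measurable measurable_fst).mul_const _)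
            (.of_forall fun p => ?_)
          rw [← sub_mul, norm_mul]
          gcongr
          exact (φ.norm_coe_le_norm _).trans (by linarith)
      _ = (∫ y, ‖w y - g y‖ ∂m) * (‖φ‖ + 1) := by rw [integral_mul_const, hmap]
      _ ≤ ε / 2 / (‖φ‖ + 1) * (‖φ‖ + 1) := by gcongr
      _ = ε / 2 := by field_simp
      _ < ε := by linarith

/-- A minimax principle: a family of continuous functionals, affine on a compact space closed under
convex combinations, has a common zero as soon as no finite linear combination of them is bounded
below by a positive number. -/
lemma exists_forall_eq_zero_of_forall_exists_sum_le {E ι : Type*} [TopologicalSpace E]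
    [CompactSpace E] (L : ι → E → ℝ) (hL : ∀ i, Continuous (L i))
    (hconv : ∀ x y : E, ∀ a b : ℝ, 0 ≤ a → 0 ≤ b → a + b = 1 →
      ∃ z, ∀ i, L i z = a * L i x + b * L i y)
    (h : ∀ (s : Finset ι) (a : ι → ℝ) (δ : ℝ), 0 < δ → ∃ x, ∑ i ∈ s, a i * L i x ≤ δ) :
    ∃ x, ∀ i, L i x = 0 := by
  classical
  suffices H : (Set.univ ∩ ⋂ i, {x | L i x = 0}).Nonempty by
    obtain ⟨x, -, hx⟩ := H
    exact ⟨x, fun i => Set.mem_iInter.1 hx i⟩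
  refine isCompact_univ.inter_iInter_nonempty _
    (fun i => isClosed_eq (hL i) continuous_const) fun s => ?_
  let T : E → s → ℝ := fun x i => L i x
  suffices H : (0 : s → ℝ) ∈ Set.range T by
    obtain ⟨x, hx⟩ := H
    exact ⟨x, trivial, Set.mem_iInter₂.2 fun i hi => congrFun hx ⟨i, hi⟩⟩
  by_contra hT
  have hconvT : Convex ℝ (Set.range T) := by
    rintro _ ⟨x, rfl⟩ _ ⟨y, rfl⟩ a b ha hb hab
    obtain ⟨z, hz⟩ := hconv x y a b ha hb hab
    exact ⟨z, funext fun i => hz i⟩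
  have hclosed : IsClosed (Set.range T) :=
    (isCompact_range (continuous_pi fun i : s => hL i)).isClosed
  obtain ⟨F, u, hu, hF⟩ := geometric_hahn_banach_point_closed hconvT hclosed hT
  rw [map_zero] at hu
  obtain ⟨x, hx⟩ := h s (fun i => if hi : i ∈ s then F (Pi.single ⟨i, hi⟩ 1) else 0) u hu
  refine (hF (T x) ⟨x, rfl⟩).not_ge (le_of_eq_of_le ?_ hx)
  rw [← Finset.sum_coe_sort s]
  have := LinearMap.pi_apply_eq_sum_univ F.toLinearMap (T x)
  simp only [ContinuousLinearMap.coe_coe] at this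
  rw [this]
  refine Finset.sum_congr rfl fun i _ => ?_
  simp only [i.2, dite_true, smul_eq_mul, T, mul_comm]
  congr 2
  ext j
  simp [Pi.single_apply, eq_comm]

/-- The disintegration of `π` moves a bounded test function on the second coordinate to a weight on
the first one. -/
lemma integral_integral_mul_eq_integral_fst_compProd {Y Y' Z : Type*} [MeasurableSpace Y]
    [MeasurableSpace Y'] [MeasurableSpace Z] [StandardBorelSpace Z] [Nonempty Z]
    (π : Measure (Y × Z)) [IsProbabilityMeasure π] (κ : Kernel Y Y') [IsMarkovKernel κ]
    {φ : Y' → ℝ} {g : Z → ℝ} {M N : ℝ} (hφ : Measurable φ) (hg : Measurable g)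
    (hM : ∀ y, |φ y| ≤ M) (hN : ∀ z, |g z| ≤ N) :
    ∫ p, (∫ y, φ y ∂κ p.1) * g p.2 ∂π =
      ∫ q, (∫ z, g z ∂π.condKernel q.1) * φ q.2 ∂(π.fst ⊗ₘ κ) := by
  have hw : Measurable fun y => ∫ z, g z ∂π.condKernel y :=
    hg.stronglyMeasurable.integral_kernel.measurable
  have hk : Measurable fun y => ∫ y', φ y' ∂κ y :=
    hφ.stronglyMeasurable.integral_kernel.measurable
  have habs : ∀ {a b : ℝ}, |a| ≤ M → |b| ≤ N → |a * b| ≤ M * N := fun ha hb => by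
    rw [abs_mul]; exact mul_le_mul ha hb (abs_nonneg _) ((abs_nonneg _).trans ha)
  conv_lhs => rw [← π.disintegrate π.condKernel]
  rw [Measure.integral_compProd, Measure.integral_compProd]
  · simp only [integral_const_mul]
    simp only [mul_comm]
  · refine integrable_of_measurable_of_abs_le (M := M * N)
      ((hw.comp measurable_fst).mul (hφ.comp measurable_snd)) fun q => ?_
    rw [mul_comm]
    exact habs (hM _) (abs_integral_le_of_abs_le hN)
  · exact integrable_of_measurable_of_abs_le (M := M * N)
      ((hk.comp measurable_fst).mul (hg.comp measurable_snd))
      fun q => habs (abs_integral_le_of_abs_le hM) (hN _)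

end Compactness

section Separation

lemma ext_of_integral_indicator_mul_boundedContinuousFunction {X Y₁ Y₂ : Type*} [MeasurableSpace X]
    [TopologicalSpace Y₁] [MeasurableSpace Y₁] [BorelSpace Y₁] [HasOuterApproxClosed Y₁]
    [TopologicalSpace Y₂] [MeasurableSpace Y₂] [BorelSpace Y₂] [HasOuterApproxClosed Y₂]
    {P Q : Measure (X × Y₁ × Y₂)} [IsFiniteMeasure P] [IsFiniteMeasure Q]
    (h : ∀ A : Set X, MeasurableSet A → ∀ (φ : Y₁ →ᵇ ℝ) (ψ : Y₂ →ᵇ ℝ),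
      ∫ p, A.indicator 1 p.1 * φ p.2.1 * ψ p.2.2 ∂P =
        ∫ p, A.indicator 1 p.1 * φ p.2.1 * ψ p.2.2 ∂Q) :
    P = Q := by
  refine Measure.ext_prod₃ fun {A B C} hA hB hC => ?_
  have hA' : MeasurableSet (Prod.fst ⁻¹' A : Set (X × Y₁ × Y₂)) := measurable_fst hA
  have hint : ∀ (m : Measure (X × Y₁ × Y₂)) (φ : Y₁ →ᵇ ℝ) (ψ : Y₂ →ᵇ ℝ),
      ∫ z, φ z.1 * ψ z.2 ∂(m.restrict (Prod.fst ⁻¹' A)).map Prod.snd =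
        ∫ p, A.indicator 1 p.1 * φ p.2.1 * ψ p.2.2 ∂m := fun m φ ψ => by
    have hm : Measurable fun z : Y₁ × Y₂ => φ z.1 * ψ z.2 :=
      (φ.continuous.measurable.comp measurable_fst).mul
        (ψ.continuous.measurable.comp measurable_snd)
    rw [integral_map measurable_snd.aemeasurable hm.aestronglyMeasurable, ← integral_indicator hA']
    refine integral_congr_ae (.of_forall fun p => ?_)
    by_cases hp : p.1 ∈ A <;> simp [hp]
  have hmap : (P.restrict (Prod.fst ⁻¹' A)).map Prod.snd =
      (Q.restrict (Prod.fst ⁻¹' A)).map Prod.snd :=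
    Measure.ext_of_integral_mul_boundedContinuousFunction fun φ ψ => by
      rw [hint P, hint Q, h A hA φ ψ]
  have hset : ∀ m : Measure (X × Y₁ × Y₂), m (A ×ˢ B ×ˢ C) =
      (m.restrict (Prod.fst ⁻¹' A)).map Prod.snd (B ×ˢ C) := fun m => by
    rw [Measure.map_apply measurable_snd (hB.prod hC),
      Measure.restrict_apply (measurable_snd (hB.prod hC))]
    congr 1
    ext p
    simp [and_comm]
  rw [hset P, hset Q, hmap]

lemma isClosed_fst_eq {Y Z : Type*} [TopologicalSpace Y] [MeasurableSpace Y] [BorelSpace Y]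
    [HasOuterApproxClosed Y] [TopologicalSpace Z] [MeasurableSpace Z]
    [OpensMeasurableSpace (Y × Z)] (m : Measure Y) [hm : IsProbabilityMeasure m] :
    IsClosed {q : ProbabilityMeasure (Y × Z) | (q : Measure (Y × Z)).fst = m} := by
  have : {q : ProbabilityMeasure (Y × Z) | (q : Measure (Y × Z)).fst = m} =
      (fun q : ProbabilityMeasure (Y × Z) => q.map measurable_fst.aemeasurable) ⁻¹'
        {(⟨m, hm⟩ : ProbabilityMeasure Y)} := by
    ext q
    exact ⟨fun h => Subtype.ext h, fun h => congrArg Subtype.val h⟩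
  rw [this]
  exact isClosed_singleton.preimage (ProbabilityMeasure.continuous_map continuous_fst)

lemma exists_convexCombination_of_fst_eq {Y Z : Type*} [MeasurableSpace Y] [MeasurableSpace Z]
    {m : Measure Y} (q r : ProbabilityMeasure (Y × Z)) (hq : (q : Measure (Y × Z)).fst = m)
    (hr : (r : Measure (Y × Z)).fst = m) {a b : ℝ} (ha : 0 ≤ a) (hb : 0 ≤ b) (hab : a + b = 1) :
    ∃ s : ProbabilityMeasure (Y × Z), (s : Measure (Y × Z)).fst = m ∧ ∀ f : Y × Z → ℝ,
      Integrable f (q : Measure (Y × Z)) → Integrable f (r : Measure (Y × Z)) →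
      ∫ p, f p ∂(s : Measure (Y × Z)) =
        a * ∫ p, f p ∂(q : Measure (Y × Z)) + b * ∫ p, f p ∂(r : Measure (Y × Z)) := by
  have hsum : ENNReal.ofReal a + ENNReal.ofReal b = 1 := by
    rw [← ENNReal.ofReal_add ha hb, hab, ENNReal.ofReal_one]
  let s : Measure (Y × Z) := ENNReal.ofReal a • (q : Measure (Y × Z)) +
    ENNReal.ofReal b • (r : Measure (Y × Z))
  have hs : IsProbabilityMeasure s := ⟨by simp [s, hsum]⟩
  refine ⟨⟨s, hs⟩, ?_, fun f hfq hfr => ?_⟩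
  · change s.map Prod.fst = m
    rw [Measure.map_add _ _ measurable_fst, Measure.map_smul, Measure.map_smul]
    change ENNReal.ofReal a • (q : Measure (Y × Z)).fst +
      ENNReal.ofReal b • (r : Measure (Y × Z)).fst = m
    rw [hq, hr, ← add_smul, hsum, one_smul]
  · change ∫ p, f p ∂s = _
    rw [integral_add_measure (hfq.smul_measure ENNReal.ofReal_ne_top)
      (hfr.smul_measure ENNReal.ofReal_ne_top), integral_smul_measure, integral_smul_measure,
      ENNReal.toReal_ofReal ha, ENNReal.toReal_ofReal hb, smul_eq_mul, smul_eq_mul]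

/-- A compact metric space in any universe has a homeomorphic copy in `Type`. -/
lemma exists_homeomorph_compact_type (Y : Type*) [MetricSpace Y] [CompactSpace Y] [Nonempty Y] :
    ∃ (U : Type) (_ : MetricSpace U) (_ : CompactSpace U), Nonempty (Y ≃ₜ U) :=
  ⟨Set.range (kuratowskiEmbedding Y), inferInstance, isCompact_iff_compactSpace.1
    (isCompact_range (kuratowskiEmbedding.isometry Y).continuous),
    ⟨(kuratowskiEmbedding.isometry Y).isometryEquivOnRange.toHomeomorph⟩⟩

lemma abs_indicator_mul_mul_le {X Y₁ Y₂ : Type*} [TopologicalSpace Y₁] [TopologicalSpace Y₂]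
    (A : Set X) (φ : Y₁ →ᵇ ℝ) (ψ : Y₂ →ᵇ ℝ) (x : X) (y₁ : Y₁) (y₂ : Y₂) :
    |A.indicator 1 x * φ y₁ * ψ y₂| ≤ ‖φ‖ * ‖ψ‖ := by
  have h₀ : |A.indicator (1 : X → ℝ) x| ≤ 1 := by by_cases hx : x ∈ A <;> simp [hx]
  have h₁ : |φ y₁| ≤ ‖φ‖ := φ.norm_coe_le_norm y₁
  have h₂ : |ψ y₂| ≤ ‖ψ‖ := ψ.norm_coe_le_norm y₂
  rw [abs_mul, abs_mul]
  calc _ ≤ 1 * ‖φ‖ * ‖ψ‖ := by gcongr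
    _ = _ := by ring

lemma measurable_indicator_mul_mul {X Y₁ Y₂ : Type*} [MeasurableSpace X]
    [TopologicalSpace Y₁] [MeasurableSpace Y₁] [OpensMeasurableSpace Y₁]
    [TopologicalSpace Y₂] [MeasurableSpace Y₂] [OpensMeasurableSpace Y₂]
    {A : Set X} (hA : MeasurableSet A) (φ : Y₁ →ᵇ ℝ) (ψ : Y₂ →ᵇ ℝ) :
    Measurable fun p : X × Y₁ × Y₂ => A.indicator (1 : X → ℝ) p.1 * φ p.2.1 * ψ p.2.2 :=
  (((measurable_one.indicator hA).comp measurable_fst).mul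
    (φ.continuous.measurable.comp (by fun_prop))).mul (ψ.continuous.measurable.comp (by fun_prop))

variable {X Y₁ Y₂ : Type*} [MeasurableSpace X]
  [MetricSpace Y₁] [MeasurableSpace Y₁] [BorelSpace Y₁]
  [MetricSpace Y₂] [MeasurableSpace Y₂] [BorelSpace Y₂]

lemma exists_weight_garbleFirst [StandardBorelSpace X] [StandardBorelSpace Y₂]
    (P : Measure (X × Y₁ × Y₂)) [IsProbabilityMeasure P]
    {A : Set X} (hA : MeasurableSet A) (φ : Y₁ →ᵇ ℝ) (ψ : Y₂ →ᵇ ℝ) :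
    ∃ w : Y₁ → ℝ, Measurable w ∧ (∃ N, ∀ y, |w y| ≤ N) ∧
      ∀ κ : Kernel Y₁ Y₁, IsMarkovKernel κ →
        ∫ p, A.indicator 1 p.1 * φ p.2.1 * ψ p.2.2 ∂garbleFirst P κ =
          ∫ q, w q.1 * φ q.2 ∂(P.map (fun p => p.2.1) ⊗ₘ κ) := by
  have : Nonempty (X × Y₂) := P.nonempty_of_neZero.map fun p => (p.1, p.2.2)
  set π : Measure (Y₁ × X × Y₂) := P.map fun p => (p.2.1, p.1, p.2.2) with hπ
  have : IsProbabilityMeasure π := Measure.isProbabilityMeasure_map (by fun_prop)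
  have hfst : π.fst = P.map (fun p => p.2.1) := by
    rw [Measure.fst, hπ, Measure.map_map measurable_fst (by fun_prop)]
    rfl
  have hg : Measurable fun z : X × Y₂ => A.indicator (1 : X → ℝ) z.1 * ψ z.2 :=
    ((measurable_one.indicator hA).comp measurable_fst).mul
      (ψ.continuous.measurable.comp measurable_snd)
  have hN : ∀ z : X × Y₂, |A.indicator (1 : X → ℝ) z.1 * ψ z.2| ≤ ‖ψ‖ := fun z => by
    have := ψ.norm_coe_le_norm z.2
    by_cases hz : z.1 ∈ A <;> simp_all
  refine ⟨fun y => ∫ z, A.indicator 1 z.1 * ψ z.2 ∂π.condKernel y,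
    hg.stronglyMeasurable.integral_kernel.measurable,
    ⟨‖ψ‖, fun y => abs_integral_le_of_abs_le hN⟩, fun κ hκ => ?_⟩
  have hk : Measurable fun y => ∫ y', φ y' ∂κ y :=
    φ.continuous.measurable.stronglyMeasurable.integral_kernel.measurable
  have hm : Measurable fun q : Y₁ × X × Y₂ =>
      (∫ y, φ y ∂κ q.1) * (A.indicator (1 : X → ℝ) q.2.1 * ψ q.2.2) :=
    (hk.comp measurable_fst).mul (hg.comp measurable_snd)
  rw [← hfst, ← integral_integral_mul_eq_integral_fst_compProd π κ φ.continuous.measurable hg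
    (fun y => φ.norm_coe_le_norm y) hN, hπ, integral_map (by fun_prop) hm.aestronglyMeasurable,
    integral_garbleFirst P κ (measurable_indicator_mul_mul hA φ ψ)
      fun _ => abs_indicator_mul_mul_le ..]
  refine integral_congr_ae (.of_forall fun p => ?_)
  dsimp only
  rw [integral_mul_const, integral_const_mul]
  ring

lemma exists_weight_garbleSecond [StandardBorelSpace X] [StandardBorelSpace Y₁]
    (P : Measure (X × Y₁ × Y₂)) [IsProbabilityMeasure P]
    {A : Set X} (hA : MeasurableSet A) (φ : Y₁ →ᵇ ℝ) (ψ : Y₂ →ᵇ ℝ) :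
    ∃ w : Y₂ → ℝ, Measurable w ∧ (∃ N, ∀ y, |w y| ≤ N) ∧
      ∀ κ : Kernel Y₂ Y₂, IsMarkovKernel κ →
        ∫ p, A.indicator 1 p.1 * φ p.2.1 * ψ p.2.2 ∂garbleSecond P κ =
          ∫ q, w q.1 * ψ q.2 ∂(P.map (fun p => p.2.2) ⊗ₘ κ) := by
  let σ : X × Y₁ × Y₂ → X × Y₂ × Y₁ := fun p => (p.1, p.2.2, p.2.1)
  have hσ : Measurable σ := by fun_prop
  have : IsProbabilityMeasure (P.map σ) := Measure.isProbabilityMeasure_map hσ.aemeasurable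
  obtain ⟨w, hw, hN, h⟩ := exists_weight_garbleFirst (P.map σ) hA ψ φ
  refine ⟨w, hw, hN, fun κ hκ => ?_⟩
  have hmap : (P.map σ).map (fun p => p.2.1) = P.map fun p => p.2.2 :=
    Measure.map_map (by fun_prop) hσ
  have hF := measurable_indicator_mul_mul hA ψ φ
  rw [← hmap, ← h κ hκ, integral_garbleFirst _ κ hF fun _ => abs_indicator_mul_mul_le ..,
    integral_garbleSecond P κ (measurable_indicator_mul_mul hA φ ψ)
      fun _ => abs_indicator_mul_mul_le .., integral_map hσ.aemeasurable]
  · simp only [σ, mul_right_comm]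
  · have : StronglyMeasurable fun q : (X × Y₂ × Y₁) × Y₂ =>
        A.indicator (1 : X → ℝ) q.1.1 * ψ q.2 * φ q.1.2.2 :=
      (hF.comp (by fun_prop : Measurable fun q : (X × Y₂ × Y₁) × Y₂ =>
        (q.1.1, q.2, q.1.2.2))).stronglyMeasurable
    exact (this.integral_kernel_prod_right'
      (κ := κ.comap (fun p : X × Y₂ × Y₁ => p.2.1) (by fun_prop))).aestronglyMeasurable

/-- If no finite combination of product test functions strictly separates the garblings of `ν`
from those of `μ`, the two sets of garblings meet. -/
lemma exists_garbleFirst_eq_garbleSecond [CompactSpace Y₁] [CompactSpace Y₂] [Nonempty Y₁]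
    [Nonempty Y₂] [StandardBorelSpace X]
    (μ ν : Measure (X × Y₁ × Y₂)) [IsProbabilityMeasure μ] [IsProbabilityMeasure ν]
    (h : ∀ (s : Finset ({A : Set X // MeasurableSet A} × (Y₁ →ᵇ ℝ) × (Y₂ →ᵇ ℝ)))
      (a : {A : Set X // MeasurableSet A} × (Y₁ →ᵇ ℝ) × (Y₂ →ᵇ ℝ) → ℝ) (δ : ℝ), 0 < δ →
      ∃ (κ₁ : Kernel Y₁ Y₁) (κ₂ : Kernel Y₂ Y₂), IsMarkovKernel κ₁ ∧ IsMarkovKernel κ₂ ∧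
        ∑ t ∈ s, a t *
          ∫ p, t.1.1.indicator 1 p.1 * t.2.1 p.2.1 * t.2.2 p.2.2 ∂garbleFirst ν κ₁ ≤
        ∑ t ∈ s, a t *
          ∫ p, t.1.1.indicator 1 p.1 * t.2.1 p.2.1 * t.2.2 p.2.2 ∂garbleSecond μ κ₂ + δ) :
    ∃ (κ₁ : Kernel Y₁ Y₁) (κ₂ : Kernel Y₂ Y₂), IsMarkovKernel κ₁ ∧ IsMarkovKernel κ₂ ∧
      garbleFirst ν κ₁ = garbleSecond μ κ₂ := by
  set m₁ := ν.map (fun p => p.2.1) with hm₁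
  set m₂ := μ.map (fun p => p.2.2) with hm₂
  have : IsProbabilityMeasure m₁ := Measure.isProbabilityMeasure_map (by fun_prop)
  have : IsProbabilityMeasure m₂ := Measure.isProbabilityMeasure_map (by fun_prop)
  choose w hw hwN hwκ using fun t : {A : Set X // MeasurableSet A} × (Y₁ →ᵇ ℝ) × (Y₂ →ᵇ ℝ) =>
    exists_weight_garbleFirst ν t.1.2 t.2.1 t.2.2
  choose v hv hvN hvκ using fun t : {A : Set X // MeasurableSet A} × (Y₁ →ᵇ ℝ) × (Y₂ →ᵇ ℝ) =>
    exists_weight_garbleSecond μ t.1.2 t.2.1 t.2.2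
  let K : Set (ProbabilityMeasure (Y₁ × Y₁) × ProbabilityMeasure (Y₂ × Y₂)) :=
    {q : ProbabilityMeasure (Y₁ × Y₁) | (q : Measure (Y₁ × Y₁)).fst = m₁} ×ˢ
      {q : ProbabilityMeasure (Y₂ × Y₂) | (q : Measure (Y₂ × Y₂)).fst = m₂}
  have hK : IsCompact K := ((isClosed_fst_eq m₁).prod (isClosed_fst_eq m₂)).isCompact
  have : CompactSpace K := isCompact_iff_compactSpace.1 hK
  have hint₁ : ∀ t (q : ProbabilityMeasure (Y₁ × Y₁)),
      Integrable (fun p => w t p.1 * t.2.1 p.2) (q : Measure (Y₁ × Y₁)) := fun t q => by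
    obtain ⟨N, hN⟩ := hwN t
    exact ((integrable_of_measurable_of_abs_le ((hw t).comp measurable_fst) fun _ => hN _).mul_bdd
      (t.2.1.continuous.measurable.comp measurable_snd).aestronglyMeasurable
      (.of_forall fun p => t.2.1.norm_coe_le_norm _))
  have hint₂ : ∀ t (q : ProbabilityMeasure (Y₂ × Y₂)),
      Integrable (fun p => v t p.1 * t.2.2 p.2) (q : Measure (Y₂ × Y₂)) := fun t q => by
    obtain ⟨N, hN⟩ := hvN t
    exact ((integrable_of_measurable_of_abs_le ((hv t).comp measurable_fst) fun _ => hN _).mul_bdd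
      (t.2.2.continuous.measurable.comp measurable_snd).aestronglyMeasurable
      (.of_forall fun p => t.2.2.norm_coe_le_norm _))
  have hL : ∃ x : K, ∀ t, ∫ p, w t p.1 * t.2.1 p.2 ∂(x.1.1 : Measure (Y₁ × Y₁)) -
      ∫ p, v t p.1 * t.2.2 p.2 ∂(x.1.2 : Measure (Y₂ × Y₂)) = 0 := by
    refine exists_forall_eq_zero_of_forall_exists_sum_le _ ?_ ?_ ?_
    · intro t
      obtain ⟨N, hN⟩ := hwN t
      obtain ⟨N', hN'⟩ := hvN t
      have h₁ := continuousOn_integral_mul_of_fst_eq m₁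
        (integrable_of_measurable_of_abs_le (hw t) hN) t.2.1
      have h₂ := continuousOn_integral_mul_of_fst_eq m₂
        (integrable_of_measurable_of_abs_le (hv t) hN') t.2.2
      exact continuousOn_iff_continuous_domRestrict.1
        ((h₁.comp continuousOn_fst fun x hx => hx.1).sub
          (h₂.comp continuousOn_snd fun x hx => hx.2))
    · rintro ⟨⟨q, r⟩, hq, hr⟩ ⟨⟨q', r'⟩, hq', hr'⟩ a b ha hb hab
      obtain ⟨q'', hq'', hqi⟩ := exists_convexCombination_of_fst_eq q q' hq hq' ha hb hab
      obtain ⟨r'', hr'', hri⟩ := exists_convexCombination_of_fst_eq r r' hr hr' ha hb hab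
      refine ⟨⟨⟨q'', r''⟩, hq'', hr''⟩, fun t => ?_⟩
      dsimp only
      rw [hqi _ (hint₁ t q) (hint₁ t q'), hri _ (hint₂ t r) (hint₂ t r')]
      ring
    · intro s a δ hδ
      obtain ⟨κ₁, κ₂, h₁, h₂, hle⟩ := h s a δ hδ
      refine ⟨⟨⟨⟨m₁ ⊗ₘ κ₁, inferInstance⟩, ⟨m₂ ⊗ₘ κ₂, inferInstance⟩⟩,
        Measure.fst_compProd _ _, Measure.fst_compProd _ _⟩, ?_⟩
      simp only [fun t => hwκ t κ₁ h₁, fun t => hvκ t κ₂ h₂] at hle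
      simpa only [mul_sub, Finset.sum_sub_distrib, sub_le_iff_le_add'] using! hle
  obtain ⟨⟨⟨q, r⟩, hq, hr⟩, hzero⟩ := hL
  refine ⟨(q : Measure (Y₁ × Y₁)).condKernel, (r : Measure (Y₂ × Y₂)).condKernel,
    inferInstance, inferInstance,
    ext_of_integral_indicator_mul_boundedContinuousFunction fun A hA φ ψ => ?_⟩
  have h₁ := hwκ (⟨A, hA⟩, φ, ψ) (q : Measure (Y₁ × Y₁)).condKernel inferInstance
  have h₂ := hvκ (⟨A, hA⟩, φ, ψ) (r : Measure (Y₂ × Y₂)).condKernel inferInstance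
  have hq' : (q : Measure (Y₁ × Y₁)).fst = m₁ := hq
  have hr' : (r : Measure (Y₂ × Y₂)).fst = m₂ := hr
  rw [← hm₁, ← hq', Measure.disintegrate] at h₁
  rw [← hm₂, ← hr', Measure.disintegrate] at h₂
  exact h₁.trans ((sub_eq_zero.1 (hzero (⟨A, hA⟩, φ, ψ))).trans h₂.symm)

end Separation

section Game

variable {X Y₁ Y₂ U₁ U₂ : Type*} [MeasurableSpace X]
  [TopologicalSpace Y₁] [MeasurableSpace Y₁] [BorelSpace Y₁]
  [TopologicalSpace Y₂] [MeasurableSpace Y₂] [BorelSpace Y₂]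
  [TopologicalSpace U₁] [MeasurableSpace U₁] [BorelSpace U₁]
  [TopologicalSpace U₂] [MeasurableSpace U₂] [BorelSpace U₂]

/-- If `μ` is better for the maximizer over all games with actions in copies `U₁`, `U₂` of the
measurement spaces, no finite combination of product test functions strictly separates the
garblings of `ν` from those of `μ`. -/
lemma exists_sum_integral_le_of_forall_gameValue_le [Nonempty Y₁] [Nonempty Y₂]
    {μ ν : Measure (X × Y₁ × Y₂)} [IsProbabilityMeasure μ] [IsProbabilityMeasure ν]
    (e₁ : Y₁ ≃ₜ U₁) (e₂ : Y₂ ≃ₜ U₂)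
    (h : ∀ c : X → U₁ → U₂ → ℝ, (∃ M : ℝ, ∀ x u₁ u₂, |c x u₁ u₂| ≤ M) →
      (Measurable fun p : X × U₁ × U₂ => c p.1 p.2.1 p.2.2) →
      (∀ x, Continuous fun q : U₁ × U₂ => c x q.1 q.2) → gameValue ν c ≤ gameValue μ c)
    (s : Finset ({A : Set X // MeasurableSet A} × (Y₁ →ᵇ ℝ) × (Y₂ →ᵇ ℝ)))
    (a : {A : Set X // MeasurableSet A} × (Y₁ →ᵇ ℝ) × (Y₂ →ᵇ ℝ) → ℝ) {δ : ℝ} (hδ : 0 < δ) :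
    ∃ (κ₁ : Kernel Y₁ Y₁) (κ₂ : Kernel Y₂ Y₂), IsMarkovKernel κ₁ ∧ IsMarkovKernel κ₂ ∧
      ∑ t ∈ s, a t *
        ∫ p, t.1.1.indicator 1 p.1 * t.2.1 p.2.1 * t.2.2 p.2.2 ∂garbleFirst ν κ₁ ≤
      ∑ t ∈ s, a t *
        ∫ p, t.1.1.indicator 1 p.1 * t.2.1 p.2.1 * t.2.2 p.2.2 ∂garbleSecond μ κ₂ + δ := by
  have : Nonempty U₂ := e₂.symm.nonempty
  let f : X → Y₁ → Y₂ → ℝ := fun x y₁ y₂ =>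
    ∑ t ∈ s, a t * (t.1.1.indicator 1 x * t.2.1 y₁ * t.2.2 y₂)
  have hM : ∀ x y₁ y₂, |f x y₁ y₂| ≤ ∑ t ∈ s, |a t| * (‖t.2.1‖ * ‖t.2.2‖) :=
    fun x y₁ y₂ => (Finset.abs_sum_le_sum_abs _ _).trans <| Finset.sum_le_sum fun t _ => by
      rw [abs_mul]
      exact mul_le_mul_of_nonneg_left (abs_indicator_mul_mul_le ..) (abs_nonneg _)
  have hf : Measurable fun p : X × Y₁ × Y₂ => f p.1 p.2.1 p.2.2 :=
    Finset.measurable_fun_sum _ fun t _ =>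
      (measurable_indicator_mul_mul t.1.2 t.2.1 t.2.2).const_mul _
  have hsum : ∀ (P : Measure (X × Y₁ × Y₂)) [IsProbabilityMeasure P],
      ∫ p, f p.1 p.2.1 p.2.2 ∂P =
        ∑ t ∈ s, a t * ∫ p, t.1.1.indicator 1 p.1 * t.2.1 p.2.1 * t.2.2 p.2.2 ∂P :=
    fun P _ => by
      simp only [f, ← integral_const_mul]
      exact integral_finsetSum _ fun t _ => (integrable_of_measurable_of_abs_le
        (measurable_indicator_mul_mul t.1.2 t.2.1 t.2.2)
        fun _ => abs_indicator_mul_mul_le ..).const_mul _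
  have hfc : ∀ x, Continuous fun q : Y₁ × Y₂ => f x q.1 q.2 := fun x =>
    continuous_finsetSum _ fun t _ => by fun_prop
  clear_value f
  have hval := h (fun x u₁ u₂ => f x (e₁.symm u₁) (e₂.symm u₂)) ⟨_, fun _ _ _ => hM _ _ _⟩
    (hf.comp (measurable_fst.prodMk ((e₁.symm.measurable.comp (by fun_prop)).prodMk
      (e₂.symm.measurable.comp (by fun_prop)))))
    fun x => (hfc x).comp (by fun_prop : Continuous fun q : U₁ × U₂ => (e₁.symm q.1, e₂.symm q.2))
  obtain ⟨κ₁, κ₂, h₁, h₂, hle⟩ := exists_integral_le_of_gameValue_le hM hf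
    e₁.toMeasurableEquiv e₂.toMeasurableEquiv hval hδ
  refine ⟨κ₁, κ₂, h₁, h₂, ?_⟩
  rwa [← hsum, ← hsum, integral_garbleFirst ν κ₁ hf fun _ => hM _ _ _,
    integral_garbleSecond μ κ₂ hf fun _ => hM _ _ _]

end Game

/-- main theorem: the standard Borel generalization of Pęski's
characterization. An information structure `μ` satisfying Assumption 2.1 is better for
the maximizer than another such `ν` over all games in the class `G̃` (nonempty compact
metric action spaces and bounded measurable costs continuous in the actions) if and only
if there exist Markov kernels `κ₁ : Y₁ → Y₁` and `κ₂ : Y₂ → Y₂` with `κ₁ν = κ₂μ`. -/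
theorem comparison_of_information_structures_zero_sum
    {X Y₁ Y₂ : Type*} [MeasurableSpace X] [StandardBorelSpace X]
    [MetricSpace Y₁] [CompactSpace Y₁] [Nonempty Y₁] [MeasurableSpace Y₁] [BorelSpace Y₁]
    [MetricSpace Y₂] [CompactSpace Y₂] [Nonempty Y₂] [MeasurableSpace Y₂] [BorelSpace Y₂]
    (ζ : Measure X) [IsProbabilityMeasure ζ]
    (μ ν : Measure (X × Y₁ × Y₂)) [IsProbabilityMeasure μ] [IsProbabilityMeasure ν]
    (hμmarg : μ.map Prod.fst = ζ) (hνmarg : ν.map Prod.fst = ζ)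
    (hμac : ∃ (Q₁ : Measure Y₁) (Q₂ : Measure Y₂), IsProbabilityMeasure Q₁ ∧
      IsProbabilityMeasure Q₂ ∧ μ ≪ ζ.prod (Q₁.prod Q₂))
    (hνac : ∃ (Q₁ : Measure Y₁) (Q₂ : Measure Y₂), IsProbabilityMeasure Q₁ ∧
      IsProbabilityMeasure Q₂ ∧ ν ≪ ζ.prod (Q₁.prod Q₂)) :
    (∀ (U₁ U₂ : Type) [MetricSpace U₁] [CompactSpace U₁] [Nonempty U₁]
      [MeasurableSpace U₁] [BorelSpace U₁]
      [MetricSpace U₂] [CompactSpace U₂] [Nonempty U₂]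
      [MeasurableSpace U₂] [BorelSpace U₂],
      ∀ c : X → U₁ → U₂ → ℝ,
      (∃ M : ℝ, ∀ x u₁ u₂, |c x u₁ u₂| ≤ M) →
      (Measurable fun p : X × U₁ × U₂ => c p.1 p.2.1 p.2.2) →
      (∀ x, Continuous fun q : U₁ × U₂ => c x q.1 q.2) →
      gameValue (U₁ := U₁) (U₂ := U₂) ν c ≤ gameValue (U₁ := U₁) (U₂ := U₂) μ c)
    ↔
    (∃ (κ₁ : Kernel Y₁ Y₁) (κ₂ : Kernel Y₂ Y₂), IsMarkovKernel κ₁ ∧ IsMarkovKernel κ₂ ∧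
      ∀ (A : Set X) (B : Set Y₁) (C : Set Y₂),
        MeasurableSet A → MeasurableSet B → MeasurableSet C →
        (∫⁻ p in A ×ˢ ((Set.univ : Set Y₁) ×ˢ C), κ₁ p.2.1 B ∂ν) =
          ∫⁻ p in A ×ˢ (B ×ˢ (Set.univ : Set Y₂)), κ₂ p.2.2 C ∂μ) := by
  constructor
  · intro h
    obtain ⟨U₁, _, _, ⟨e₁⟩⟩ := exists_homeomorph_compact_type Y₁
    obtain ⟨U₂, _, _, ⟨e₂⟩⟩ := exists_homeomorph_compact_type Y₂
    let : MeasurableSpace U₁ := borel U₁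
    let : MeasurableSpace U₂ := borel U₂
    have : BorelSpace U₁ := ⟨rfl⟩
    have : BorelSpace U₂ := ⟨rfl⟩
    have : Nonempty U₁ := e₁.symm.nonempty
    have : Nonempty U₂ := e₂.symm.nonempty
    obtain ⟨κ₁, κ₂, h₁, h₂, hκ⟩ := exists_garbleFirst_eq_garbleSecond μ ν fun s a δ hδ =>
      exists_sum_integral_le_of_forall_gameValue_le e₁ e₂ (h U₁ U₂) s a hδ
    refine ⟨κ₁, κ₂, h₁, h₂, fun A B C hA hB hC => ?_⟩
    rw [← garbleFirst_prod ν κ₁ hA hB hC, ← garbleSecond_prod μ κ₂ hA hB hC, hκ]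
  · rintro ⟨κ₁, κ₂, h₁, h₂, hκ⟩ U₁ U₂ _ _ _ _ _ _ _ _ _ _ c ⟨M, hM⟩ hc -
    refine gameValue_le_gameValue_of_garble_eq hM hc κ₁ κ₂ (Measure.ext_prod₃ ?_)
    intro A B C hA hB hC
    rw [garbleFirst_prod ν κ₁ hA hB hC, garbleSecond_prod μ κ₂ hA hB hC, hκ A B C hA hB hC]
end

section
/- Let X be a standard Borel space, ζ a Borel probability measure on X, and let Y¹ and Y² be nonempty compact metric spaces. Let μ and ν be information structures on X × Y¹ × Y², each satisfying Assumption 2.1, and suppose ν = κ²μ for some Markov kernel κ² from Y² to Y² (so the maximizer's measurement under ν is a garbling of his measurement under μ, while the minimizer's measurement is unchanged). Then for every game in the class G̃ (nonempty compact metric action spaces U¹, U² and bounded jointly measurable cost c : X × U¹ × U² → ℝ continuous in (u¹,u²) for every x), V*(ν) ≤ V*(μ): the value of additional information to the maximizer is never negative in any such zero-sum game. -/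
open MeasureTheory ProbabilityTheory

/-- The measure obtained from `μ` by redrawing its last coordinate `y` from `κ y`. -/
noncomputable def garbleLast {X Y₁ Y₂ : Type*}
    [MeasurableSpace X] [MeasurableSpace Y₁] [MeasurableSpace Y₂]
    (μ : Measure (X × Y₁ × Y₂)) (κ : Kernel Y₂ Y₂) : Measure (X × Y₁ × Y₂) :=
  (μ ⊗ₘ κ.comap (fun p : X × Y₁ × Y₂ => p.2.2) (by fun_prop)).map
    fun q => (q.1.1, q.1.2.1, q.2)

theorem eq_garbleLast {X Y₁ Y₂ : Type*}
    [MeasurableSpace X] [MeasurableSpace Y₁] [MeasurableSpace Y₂]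
    {μ ν : Measure (X × Y₁ × Y₂)} [IsFiniteMeasure μ] [IsFiniteMeasure ν]
    {κ : Kernel Y₂ Y₂} [IsMarkovKernel κ]
    (h : ∀ (A : Set X) (B : Set Y₁) (C : Set Y₂),
      MeasurableSet A → MeasurableSet B → MeasurableSet C →
      ν (A ×ˢ B ×ˢ C) = ∫⁻ p in A ×ˢ (B ×ˢ (Set.univ : Set Y₂)), κ p.2.2 C ∂μ) :
    ν = garbleLast μ κ := by
  refine Measure.ext_prod₃ fun {A B C} hA hB hC => ?_
  have hpre : (fun q : (X × Y₁ × Y₂) × Y₂ => (q.1.1, q.1.2.1, q.2)) ⁻¹' (A ×ˢ B ×ˢ C)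
      = (A ×ˢ (B ×ˢ (Set.univ : Set Y₂))) ×ˢ C := by
    ext q
    simp [and_assoc]
  rw [h A B C hA hB hC, garbleLast,
    Measure.map_apply (by fun_prop) (hA.prod (hB.prod hC)), hpre,
    Measure.compProd_apply_prod (hA.prod (hB.prod .univ)) hC]
  rfl

theorem abs_integral_le_of_forall_abs_le {α : Type*} [MeasurableSpace α] {P : Measure α}
    [IsProbabilityMeasure P] {f : α → ℝ} {M : ℝ} (h : ∀ a, |f a| ≤ M) : |∫ a, f a ∂P| ≤ M := by
  simpa using norm_integral_le_of_norm_le_const (μ := P) (f := f) (C := M) (.of_forall h)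

section Cost

variable {X Y₁ Y₂ U₁ U₂ : Type*}
  [MeasurableSpace X] [MeasurableSpace Y₁] [MeasurableSpace Y₂]
  [MeasurableSpace U₁] [MeasurableSpace U₂]
  {c : X → U₁ → U₂ → ℝ}
  (γ₁ : Kernel Y₁ U₁) [IsMarkovKernel γ₁] (γ₂ : Kernel Y₂ U₂) [IsMarkovKernel γ₂]

theorem stronglyMeasurable_integral_integral_cost
    (hmeas : Measurable fun p : X × U₁ × U₂ => c p.1 p.2.1 p.2.2) :
    StronglyMeasurable fun p : X × Y₁ × Y₂ =>
      ∫ u₁, ∫ u₂, c p.1 u₁ u₂ ∂(γ₂ p.2.2) ∂(γ₁ p.2.1) := by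
  have h₂ : StronglyMeasurable fun q : (X × Y₁ × Y₂) × U₁ =>
      ∫ u₂, c q.1.1 q.2 u₂ ∂(γ₂ q.1.2.2) :=
    StronglyMeasurable.integral_kernel_prod_right'
      (κ := γ₂.comap (fun q : (X × Y₁ × Y₂) × U₁ => q.1.2.2) (by fun_prop))
      (f := fun r => c r.1.1.1 r.1.2 r.2)
      (hmeas.comp (g := fun p : X × U₁ × U₂ => c p.1 p.2.1 p.2.2)
        (f := fun r : ((X × Y₁ × Y₂) × U₁) × U₂ => (r.1.1.1, r.1.2, r.2))
        (by fun_prop)).stronglyMeasurable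
  exact h₂.integral_kernel_prod_right'
    (κ := γ₁.comap (fun p : X × Y₁ × Y₂ => p.2.1) (by fun_prop))

/-- Garbling the last measurement has the same effect on the cost as having the second player
garble it before acting. -/
theorem integral_cost_garbleLast {M : ℝ} (hM : ∀ x u₁ u₂, |c x u₁ u₂| ≤ M)
    (hmeas : Measurable fun p : X × U₁ × U₂ => c p.1 p.2.1 p.2.2)
    (μ : Measure (X × Y₁ × Y₂)) [IsFiniteMeasure μ] (κ : Kernel Y₂ Y₂) [IsMarkovKernel κ] :
    ∫ p, ∫ u₁, ∫ u₂, c p.1 u₁ u₂ ∂(γ₂ p.2.2) ∂(γ₁ p.2.1) ∂(garbleLast μ κ) =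
      ∫ p, ∫ u₁, ∫ u₂, c p.1 u₁ u₂ ∂((γ₂ ∘ₖ κ) p.2.2) ∂(γ₁ p.2.1) ∂μ := by
  have hF := stronglyMeasurable_integral_integral_cost γ₁ γ₂ hmeas
  have hφ : Measurable fun q : (X × Y₁ × Y₂) × Y₂ => (q.1.1, q.1.2.1, q.2) := by fun_prop
  rw [garbleLast, integral_map hφ.aemeasurable hF.aestronglyMeasurable,
    Measure.integral_compProd]
  · refine integral_congr_ae (.of_forall fun p => ?_)
    have hc : ∀ u₁, StronglyMeasurable (c p.1 u₁) := fun u₁ =>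
      (hmeas.comp (f := fun u₂ => (p.1, u₁, u₂)) (by fun_prop)).stronglyMeasurable
    have hcomp : ∀ u₁, ∫ u₂, c p.1 u₁ u₂ ∂((γ₂ ∘ₖ κ) p.2.2) =
        ∫ y, ∫ u₂, c p.1 u₁ u₂ ∂(γ₂ y) ∂(κ p.2.2) := fun u₁ =>
      Kernel.integral_comp (.of_bound (hc u₁).aestronglyMeasurable M (.of_forall (hM p.1 u₁)))
    simp only [hcomp, Kernel.comap_apply]
    refine integral_integral_swap (f := fun y u₁ => ∫ u₂, c p.1 u₁ u₂ ∂(γ₂ y)) ?_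
    refine .of_bound (StronglyMeasurable.aestronglyMeasurable ?_) M
      (.of_forall fun q => abs_integral_le_of_forall_abs_le (hM p.1 q.2))
    exact StronglyMeasurable.integral_kernel_prod_right'
      (κ := γ₂.comap (fun q : Y₂ × U₁ => q.1) (by fun_prop))
      (f := fun r => c p.1 r.1.2 r.2)
      (hmeas.comp (g := fun p : X × U₁ × U₂ => c p.1 p.2.1 p.2.2)
        (f := fun r : (Y₂ × U₁) × U₂ => (p.1, r.1.2, r.2)) (by fun_prop)).stronglyMeasurable
  · exact .of_bound (hF.comp_measurable hφ).aestronglyMeasurable M (.of_forall fun q =>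
      abs_integral_le_of_forall_abs_le fun u₁ => abs_integral_le_of_forall_abs_le (hM _ u₁))

end Cost

/-- more information cannot hurt the maximizer in a zero-sum game. If the
information structure `ν` is obtained from `μ` by garbling the maximizer's measurement
through a Markov kernel `κ₂` (the minimizer's measurement being unchanged), then
`V*(ν) ≤ V*(μ)` for every game in the class `G̃`. -/
theorem value_of_information_nonnegative
    {X Y₁ Y₂ : Type*} [MeasurableSpace X] [StandardBorelSpace X]
    [MetricSpace Y₁] [CompactSpace Y₁] [Nonempty Y₁] [MeasurableSpace Y₁] [BorelSpace Y₁]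
    [MetricSpace Y₂] [CompactSpace Y₂] [Nonempty Y₂] [MeasurableSpace Y₂] [BorelSpace Y₂]
    (ζ : Measure X) [IsProbabilityMeasure ζ]
    (μ ν : Measure (X × Y₁ × Y₂)) [IsProbabilityMeasure μ] [IsProbabilityMeasure ν]
    (hμmarg : μ.map Prod.fst = ζ) (hνmarg : ν.map Prod.fst = ζ)
    (hμac : ∃ (Q₁ : Measure Y₁) (Q₂ : Measure Y₂), IsProbabilityMeasure Q₁ ∧
      IsProbabilityMeasure Q₂ ∧ μ ≪ ζ.prod (Q₁.prod Q₂))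
    (hνac : ∃ (Q₁ : Measure Y₁) (Q₂ : Measure Y₂), IsProbabilityMeasure Q₁ ∧
      IsProbabilityMeasure Q₂ ∧ ν ≪ ζ.prod (Q₁.prod Q₂))
    (κ₂ : Kernel Y₂ Y₂) [IsMarkovKernel κ₂]
    (hgarb : ∀ (A : Set X) (B : Set Y₁) (C : Set Y₂),
      MeasurableSet A → MeasurableSet B → MeasurableSet C →
      ν (A ×ˢ B ×ˢ C) = ∫⁻ p in A ×ˢ (B ×ˢ (Set.univ : Set Y₂)), κ₂ p.2.2 C ∂μ)
    {U₁ U₂ : Type*} [MetricSpace U₁] [CompactSpace U₁] [Nonempty U₁]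
    [MeasurableSpace U₁] [BorelSpace U₁]
    [MetricSpace U₂] [CompactSpace U₂] [Nonempty U₂]
    [MeasurableSpace U₂] [BorelSpace U₂]
    (c : X → U₁ → U₂ → ℝ)
    (hbdd : ∃ M : ℝ, ∀ x u₁ u₂, |c x u₁ u₂| ≤ M)
    (hmeas : Measurable fun p : X × U₁ × U₂ => c p.1 p.2.1 p.2.2)
    (hcont : ∀ x, Continuous fun q : U₁ × U₂ => c x q.1 q.2) :
    gameValue (U₁ := U₁) (U₂ := U₂) ν c ≤ gameValue (U₁ := U₁) (U₂ := U₂) μ c := by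
  obtain ⟨M, hM⟩ := hbdd
  obtain rfl := eq_garbleLast hgarb
  have hJ : ∀ (P : Measure (X × Y₁ × Y₂)) [IsProbabilityMeasure P]
      (γ₁ : {κ : Kernel Y₁ U₁ // IsMarkovKernel κ}) (γ₂ : {κ : Kernel Y₂ U₂ // IsMarkovKernel κ}),
      |∫ p, ∫ u₁, ∫ u₂, c p.1 u₁ u₂ ∂(γ₂.1 p.2.2) ∂(γ₁.1 p.2.1) ∂P| ≤ M := by
    rintro P _ ⟨γ₁, _⟩ ⟨γ₂, _⟩
    exact abs_integral_le_of_forall_abs_le fun p => abs_integral_le_of_forall_abs_le fun u₁ =>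
      abs_integral_le_of_forall_abs_le (hM p.1 u₁)
  have hbddAbove : ∀ (P : Measure (X × Y₁ × Y₂)) [IsProbabilityMeasure P]
      (γ₁ : {κ : Kernel Y₁ U₁ // IsMarkovKernel κ}),
      BddAbove (Set.range fun γ₂ : {κ : Kernel Y₂ U₂ // IsMarkovKernel κ} =>
        ∫ p, ∫ u₁, ∫ u₂, c p.1 u₁ u₂ ∂(γ₂.1 p.2.2) ∂(γ₁.1 p.2.1) ∂P) := by
    rintro P _ γ₁
    exact ⟨M, Set.forall_mem_range.2 fun γ₂ => (abs_le.1 (hJ P γ₁ γ₂)).2⟩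
  let γ₀ : {κ : Kernel Y₂ U₂ // IsMarkovKernel κ} :=
    ⟨Kernel.const Y₂ (Measure.dirac (Classical.arbitrary U₂)), inferInstance⟩
  have : Nonempty {κ : Kernel Y₂ U₂ // IsMarkovKernel κ} := ⟨γ₀⟩
  refine ciInf_mono ⟨-M, Set.forall_mem_range.2 fun γ₁ => ?_⟩ fun γ₁ => ciSup_le fun γ₂ => ?_
  · exact (abs_le.1 (hJ _ γ₁ γ₀)).1.trans (le_ciSup (hbddAbove _ γ₁) γ₀)
  · have := γ₁.2
    have := γ₂.2
    rw [integral_cost_garbleLast γ₁.1 γ₂.1 hM hmeas]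
    exact le_ciSup (hbddAbove μ γ₁) ⟨γ₂.1 ∘ₖ κ₂, inferInstance⟩
end

section
/- Let X and Y be Polish spaces and μ a Borel probability measure on X × Y. For a Markov kernel κ from Y to Y, let P_κ be the probability measure on X × Y × Y defined by P_κ(A × B × C) = ∫_{A×B} κ(y)(C) μ(dx,dy) for Borel A ⊆ X, B ⊆ Y, C ⊆ Y. If (κ_n) is a sequence of Markov kernels from Y to Y such that P_{κ_n} converges weakly to a probability measure P on X × Y × Y, then there exists a Markov kernel κ̃ from Y to Y such that P = P_{κ̃}; in particular, the weak limit of a sequence of garblings of μ (composed with μ on the product space) is again induced by a garbling of μ. -/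
open MeasureTheory ProbabilityTheory Filter

open scoped NNReal ENNReal BoundedContinuousFunction

/-- Suppose `Q n → P` weakly on `S` and that all the images of `Q n` and `P` under a continuous
map `p : S → W` equal a fixed measure `μ`. Then the convergence of integrals extends to test
functions `F ∘ p * h` with `h` bounded continuous and `F` merely `μ`-integrable. -/
theorem tendsto_integral_mul_of_map_eq
    {S W : Type*} [TopologicalSpace S] [MeasurableSpace S] [OpensMeasurableSpace S]
    [TopologicalSpace W] [NormalSpace W] [MeasurableSpace W] [BorelSpace W]
    {μ : Measure W} [IsFiniteMeasure μ] [μ.WeaklyRegular]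
    {p : S → W} (hp : Continuous p)
    {Q : ℕ → ProbabilityMeasure S} {P : ProbabilityMeasure S}
    (hQ : Tendsto Q atTop (nhds P))
    (hQμ : ∀ n, (Q n : Measure S).map p = μ) (hPμ : (P : Measure S).map p = μ)
    {F : W → ℝ} (hF : Integrable F μ) (h : S →ᵇ ℝ) :
    Tendsto (fun n => ∫ s, F (p s) * h s ∂(Q n : Measure S)) atTop
      (nhds (∫ s, F (p s) * h s ∂(P : Measure S))) := by
  have approx : ∀ ν : Measure S, ν.map p = μ → ∀ g : W →ᵇ ℝ, Integrable g μ →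
      dist (∫ s, F (p s) * h s ∂ν) (∫ s, g (p s) * h s ∂ν) ≤ ‖h‖ * ∫ w, ‖F w - g w‖ ∂μ := by
    intro ν hR g hg
    have hpm : AEMeasurable p ν := hp.measurable.aemeasurable
    have hmul : ∀ {G : W → ℝ}, Integrable G μ → Integrable (fun s => G (p s) * h s) ν := by
      intro G hG
      rw [← hR] at hG
      exact (hG.comp_aemeasurable hpm).mul_bdd (c := ‖h‖)
        h.continuous.measurable.aestronglyMeasurable (ae_of_all _ h.norm_coe_le_norm)
    have hsub : Integrable (fun w => ‖F w - g w‖) (ν.map p) := hR ▸ (hF.sub hg).norm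
    rw [dist_eq_norm, ← integral_sub (hmul hF) (hmul hg), ← hR,
      integral_map hpm hsub.aestronglyMeasurable, ← integral_const_mul]
    refine norm_integral_le_of_norm_le ((hsub.comp_aemeasurable hpm).const_mul _)
      (ae_of_all _ fun s => ?_)
    rw [← sub_mul, norm_mul, mul_comm]
    exact mul_le_mul_of_nonneg_right (h.norm_coe_le_norm s) (norm_nonneg _)
  rw [Metric.tendsto_atTop]
  intro ε hε
  have hδ : 0 < ε / (3 * (‖h‖ + 1)) := by positivity
  obtain ⟨g, hg, hgi⟩ := hF.exists_boundedContinuous_integral_sub_le hδ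
  have hsmall : ‖h‖ * ∫ w, ‖F w - g w‖ ∂μ < ε / 3 := by
    calc ‖h‖ * ∫ w, ‖F w - g w‖ ∂μ ≤ ‖h‖ * (ε / (3 * (‖h‖ + 1))) := by gcongr
      _ < (‖h‖ + 1) * (ε / (3 * (‖h‖ + 1))) := by gcongr; linarith
      _ = ε / 3 := by field_simp
  have hlim := ProbabilityMeasure.tendsto_iff_forall_integral_tendsto.1 hQ
    (g.compContinuous ⟨p, hp⟩ * h)
  obtain ⟨N, hN⟩ := Metric.tendsto_atTop.1 hlim (ε / 3) (by positivity)
  refine ⟨N, fun n hn => ?_⟩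
  have h₁ := approx _ (hQμ n) g hgi
  have h₂ := approx _ hPμ g hgi
  have h₃ := hN n hn
  simp only [BoundedContinuousFunction.coe_mul, Pi.mul_apply,
    BoundedContinuousFunction.compContinuous_apply, ContinuousMap.coe_mk] at h₃
  rw [dist_comm] at h₂
  refine (dist_triangle4 _ _ _ _).trans_lt ((add_lt_add_of_lt_of_le
    (add_lt_add_of_le_of_lt h₁ h₃) h₂).trans ?_)
  linarith

/-- If `Q n → P` weakly and all these measures have the same image under `p`, then an identity
between the images under `z` of the measures `Q n` weighted by two densities factoring through `p`
passes to the limit. -/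
theorem map_withDensity_eq_of_tendsto
    {S W Z : Type*} [TopologicalSpace S] [MeasurableSpace S] [OpensMeasurableSpace S]
    [TopologicalSpace W] [NormalSpace W] [MeasurableSpace W] [BorelSpace W]
    [TopologicalSpace Z] [HasOuterApproxClosed Z] [MeasurableSpace Z] [BorelSpace Z]
    {μ : Measure W} [IsFiniteMeasure μ] [μ.WeaklyRegular]
    {p : S → W} (hp : Continuous p) {z : S → Z} (hz : Continuous z)
    {Q : ℕ → ProbabilityMeasure S} {P : ProbabilityMeasure S}
    (hQ : Tendsto Q atTop (nhds P))
    (hQμ : ∀ n, (Q n : Measure S).map p = μ) (hPμ : (P : Measure S).map p = μ)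
    {F G : W → ℝ≥0} (hF : Measurable F) (hG : Measurable G)
    (hFi : ∫⁻ w, F w ∂μ ≠ ∞) (hGi : ∫⁻ w, G w ∂μ ≠ ∞)
    (hFG : ∀ n, ((Q n : Measure S).withDensity (fun s => (F (p s) : ℝ≥0∞))).map z =
      ((Q n : Measure S).withDensity (fun s => (G (p s) : ℝ≥0∞))).map z) :
    ((P : Measure S).withDensity (fun s => (F (p s) : ℝ≥0∞))).map z =
      ((P : Measure S).withDensity (fun s => (G (p s) : ℝ≥0∞))).map z := by
  have finite : ∀ {K : W → ℝ≥0}, Measurable K → ∫⁻ w, K w ∂μ ≠ ∞ →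
      IsFiniteMeasure ((P : Measure S).withDensity (fun s => (K (p s) : ℝ≥0∞))) := by
    intro K hK hKi
    refine isFiniteMeasure_withDensity ?_
    rwa [← hPμ, lintegral_map hK.coe_nnreal_ennreal hp.measurable] at hKi
  have eval : ∀ {K : W → ℝ≥0}, Measurable K → ∀ (ν : Measure S) (h : Z →ᵇ ℝ),
      ∫ x, h x ∂((ν.withDensity (fun s => (K (p s) : ℝ≥0∞))).map z) =
        ∫ s, (K (p s) : ℝ) * h.compContinuous ⟨z, hz⟩ s ∂ν := by
    intro K hK ν h
    rw [integral_map hz.measurable.aemeasurable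
      h.continuous.measurable.aestronglyMeasurable,
      integral_withDensity_eq_integral_smul (f := fun s => K (p s))
        (hK.comp hp.measurable)]
    rfl
  have integrable : ∀ {K : W → ℝ≥0}, Measurable K → ∫⁻ w, K w ∂μ ≠ ∞ →
      Integrable (fun w => (K w : ℝ)) μ := by
    intro K hK hKi
    refine ⟨hK.coe_nnreal_real.aestronglyMeasurable, ?_⟩
    simpa [HasFiniteIntegral, enorm, lt_top_iff_ne_top] using hKi
  have := finite hF hFi
  have := finite hG hGi
  refine ext_of_forall_integral_eq_of_IsFiniteMeasure fun h => ?_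
  rw [eval hF, eval hG]
  refine tendsto_nhds_unique
    (tendsto_integral_mul_of_map_eq hp hQ hQμ hPμ (integrable hF hFi) _) ?_
  simp only [← eval hF, hFG]
  simp only [eval hG]
  exact tendsto_integral_mul_of_map_eq hp hQ hQμ hPμ (integrable hG hGi) _

/-- Integrals over a rectangle of a function of the second coordinate only, computed by
disintegrating with respect to the second marginal. -/
theorem setLIntegral_prod_snd_eq_condKernel
    {X Y : Type*} [MeasurableSpace X] [StandardBorelSpace X] [Nonempty X] [MeasurableSpace Y]
    (μ : Measure (X × Y)) [IsFiniteMeasure μ] {A : Set X} {B : Set Y}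
    (hA : MeasurableSet A) (hB : MeasurableSet B) {f : Y → ℝ≥0∞} (hf : Measurable f) :
    ∫⁻ q in A ×ˢ B, f q.2 ∂μ =
      ∫⁻ y in B, (μ.map Prod.swap).condKernel y A * f y ∂μ.snd := by
  have hfst : (μ.map Prod.swap).fst = μ.snd := Measure.fst_map_swap
  have hμ : (μ.snd ⊗ₘ (μ.map Prod.swap).condKernel).map Prod.swap = μ := by
    rw [← hfst, Measure.disintegrate, Measure.map_map measurable_swap measurable_swap]
    simp
  calc ∫⁻ q in A ×ˢ B, f q.2 ∂μ
      = ∫⁻ q in A ×ˢ B, f q.2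
          ∂((μ.snd ⊗ₘ (μ.map Prod.swap).condKernel).map Prod.swap) := by rw [hμ]
    _ = ∫⁻ r in B ×ˢ A, f r.1 ∂(μ.snd ⊗ₘ (μ.map Prod.swap).condKernel) := by
        rw [setLIntegral_map (hA.prod hB) (by fun_prop) measurable_swap, Set.preimage_swap_prod]
        rfl
    _ = _ := by
        rw [Measure.setLIntegral_compProd (by fun_prop) hB hA]
        simp [mul_comm]

/-- If the `(y, z)`-marginal of `ν` is `μ.snd ⊗ₘ κ`, then weighting `ν` by the conditional
probability of `A ×ˢ B` given `y` yields the mass that `κ`, composed with `μ`, gives to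
`A ×ˢ B ×ˢ C`. -/
theorem map_withDensity_condKernel_apply
    {X Y : Type*} [MeasurableSpace X] [StandardBorelSpace X] [Nonempty X] [MeasurableSpace Y]
    (μ : Measure (X × Y)) [IsFiniteMeasure μ] (κ : Kernel Y Y) [IsSFiniteKernel κ]
    {ν : Measure (X × Y × Y)} (hR : ν.snd = μ.snd ⊗ₘ κ) {A : Set X} {B C : Set Y}
    (hA : MeasurableSet A) (hB : MeasurableSet B) (hC : MeasurableSet C) :
    (ν.withDensity (fun s =>
      ((B.indicator (fun y => ((μ.map Prod.swap).condKernel y A).toNNReal) s.2.1 : ℝ≥0) :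
        ℝ≥0∞))).map (fun s => s.2.2) C = ∫⁻ q in A ×ˢ B, κ q.2 C ∂μ := by
  set φ : Y → ℝ≥0 := B.indicator (fun y => ((μ.map Prod.swap).condKernel y A).toNNReal)
  have hφ : Measurable φ :=
    (((μ.map Prod.swap).condKernel.measurable_coe hA).ennreal_toNNReal).indicator hB
  have hφ_coe : (fun y => (φ y : ℝ≥0∞) * κ y C) =
      B.indicator (fun y => (μ.map Prod.swap).condKernel y A * κ y C) := by
    ext y
    by_cases hy : y ∈ B <;> simp [φ, hy]
  have hCm : MeasurableSet ((fun s : X × Y × Y => s.2.2) ⁻¹' C) :=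
    (measurable_snd.comp measurable_snd) hC
  rw [Measure.map_apply (by fun_prop) hC, withDensity_apply _ hCm,
    setLIntegral_prod_snd_eq_condKernel μ hA hB (κ.measurable_coe hC),
    ← lintegral_indicator hB, ← hφ_coe]
  calc ∫⁻ s in (fun s : X × Y × Y => s.2.2) ⁻¹' C, (φ s.2.1 : ℝ≥0∞) ∂ν
      = ∫⁻ r in Set.univ ×ˢ C, (φ r.1 : ℝ≥0∞) ∂ν.snd := by
        rw [Measure.snd, setLIntegral_map (MeasurableSet.univ.prod hC) (by fun_prop)
          measurable_snd]
        congr 2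
        ext s
        simp
    _ = _ := by
        rw [hR, Measure.setLIntegral_compProd (by fun_prop) MeasurableSet.univ hC]
        simp

/-- Weighting by the indicator of `A ×ˢ B` and projecting to the last coordinate. -/
theorem map_withDensity_indicator_apply
    {X Y Z : Type*} [MeasurableSpace X] [MeasurableSpace Y] [MeasurableSpace Z]
    (ν : Measure (X × Y × Z)) {A : Set X} {B : Set Y} {C : Set Z}
    (hA : MeasurableSet A) (hB : MeasurableSet B) (hC : MeasurableSet C) :
    (ν.withDensity (fun s =>
      (((A ×ˢ B).indicator (fun _ => 1) (s.1, s.2.1) : ℝ≥0) : ℝ≥0∞))).map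
        (fun s => s.2.2) C = ν (A ×ˢ B ×ˢ C) := by
  have hCm : MeasurableSet ((fun s : X × Y × Z => s.2.2) ⁻¹' C) :=
    (measurable_snd.comp measurable_snd) hC
  have hind : (fun s : X × Y × Z =>
      (((A ×ˢ B).indicator (fun _ => 1) (s.1, s.2.1) : ℝ≥0) : ℝ≥0∞)) =
      (A ×ˢ B ×ˢ Set.univ).indicator 1 := by
    ext s
    by_cases hs : s.1 ∈ A ∧ s.2.1 ∈ B <;> simp [Set.indicator, hs]
  rw [Measure.map_apply (by fun_prop) hC, hind,
    withDensity_indicator_one (hA.prod (hB.prod MeasurableSet.univ)),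
    Measure.restrict_apply hCm]
  congr 1
  ext s
  simp only [Set.mem_inter_iff, Set.mem_preimage, Set.mem_prod, Set.mem_univ]
  tauto

/-- The weak limit of joint measures induced by garblings of `μ` is again
induced by a garbling of `μ`. If `P_n` on `X × Y × Y` is the measure induced by `μ` (on
`X × Y`) and the Markov kernel `κ_n : Y → Y` via
`P_n(A × B × C) = ∫_{A×B} κ_n(y)(C) μ(dx,dy)`, and `P_n → P` weakly, then there is a
Markov kernel `κ̃ : Y → Y` with `P(A × B × C) = ∫_{A×B} κ̃(y)(C) μ(dx,dy)`. -/
theorem weak_limit_of_garblings_is_garbling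
    {X Y : Type*} [MetricSpace X] [PolishSpace X] [MeasurableSpace X] [BorelSpace X]
    [MetricSpace Y] [PolishSpace Y] [MeasurableSpace Y] [BorelSpace Y]
    (μ : Measure (X × Y)) [IsProbabilityMeasure μ]
    (κ : ℕ → Kernel Y Y) (hκ : ∀ n, IsMarkovKernel (κ n))
    (Pn : ℕ → ProbabilityMeasure (X × Y × Y))
    (hPn : ∀ n, ∀ (A : Set X) (B C : Set Y),
      MeasurableSet A → MeasurableSet B → MeasurableSet C →
      (Pn n : Measure (X × Y × Y)) (A ×ˢ B ×ˢ C) = ∫⁻ q in A ×ˢ B, (κ n) q.2 C ∂μ)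
    (P : ProbabilityMeasure (X × Y × Y))
    (hconv : Tendsto Pn atTop (nhds P)) :
    ∃ κt : Kernel Y Y, IsMarkovKernel κt ∧
      ∀ (A : Set X) (B C : Set Y),
        MeasurableSet A → MeasurableSet B → MeasurableSet C →
        (P : Measure (X × Y × Y)) (A ×ˢ B ×ˢ C) = ∫⁻ q in A ×ˢ B, κt q.2 C ∂μ := by
  obtain ⟨⟨x₀, y₀⟩⟩ := nonempty_of_isProbabilityMeasure μ
  have : Nonempty X := ⟨x₀⟩
  have : Nonempty Y := ⟨y₀⟩
  have hp : Continuous (fun s : X × Y × Y => (s.1, s.2.1)) := by fun_prop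
  have hz : Continuous (fun s : X × Y × Y => s.2.2) := by fun_prop
  have hPnμ : ∀ n, (Pn n : Measure (X × Y × Y)).map (fun s => (s.1, s.2.1)) = μ := by
    intro n
    have := Measure.isProbabilityMeasure_map (μ := (Pn n : Measure (X × Y × Y)))
      hp.measurable.aemeasurable
    refine Measure.ext_prod fun {A B} hA hB => ?_
    rw [Measure.map_apply hp.measurable (hA.prod hB)]
    have hpre : (fun s : X × Y × Y => (s.1, s.2.1)) ⁻¹' (A ×ˢ B) = A ×ˢ B ×ˢ Set.univ := by
      ext s
      simp
    rw [hpre, hPn n A B Set.univ hA hB MeasurableSet.univ]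
    simp
  have hPμ : (P : Measure (X × Y × Y)).map (fun s => (s.1, s.2.1)) = μ := by
    let μ' : ProbabilityMeasure (X × Y) := ⟨μ, inferInstance⟩
    have hmap := ProbabilityMeasure.tendsto_map_of_tendsto_of_continuous Pn P hconv hp
    have hconst : (fun n => (Pn n).map hp.measurable.aemeasurable) =
        fun _ => μ' := by
      ext1 n
      exact Subtype.ext (hPnμ n)
    rw [hconst] at hmap
    have hlim := tendsto_nhds_unique hmap tendsto_const_nhds
    exact congrArg Subtype.val hlim
  have hPn_snd : ∀ n, (Pn n : Measure (X × Y × Y)).snd = μ.snd ⊗ₘ κ n := by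
    intro n
    refine Measure.ext_prod fun {B C} hB hC => ?_
    rw [Measure.snd_apply (hB.prod hC), ← Set.univ_prod,
      hPn n Set.univ B C MeasurableSet.univ hB hC, Measure.compProd_apply_prod hB hC,
      Measure.snd, setLIntegral_map hB ((κ n).measurable_coe hC) measurable_snd, Set.univ_prod]
  have hP_snd : (P : Measure (X × Y × Y)).snd =
      μ.snd ⊗ₘ (P : Measure (X × Y × Y)).snd.condKernel := by
    have hfst : (P : Measure (X × Y × Y)).snd.fst = μ.snd := by
      rw [← hPμ, Measure.snd, Measure.fst, Measure.snd,
        Measure.map_map measurable_fst measurable_snd,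
        Measure.map_map measurable_snd hp.measurable]
      rfl
    rw [← hfst, Measure.disintegrate]
  refine ⟨(P : Measure (X × Y × Y)).snd.condKernel, inferInstance, fun A B C hA hB hC => ?_⟩
  have hF : Measurable ((A ×ˢ B).indicator (fun _ => 1) : X × Y → ℝ≥0) :=
    measurable_const.indicator (hA.prod hB)
  have hG : Measurable (fun w : X × Y =>
      B.indicator (fun y => ((μ.map Prod.swap).condKernel y A).toNNReal) w.2) :=
    ((((μ.map Prod.swap).condKernel.measurable_coe hA).ennreal_toNNReal).indicator hB).comp
      measurable_snd
  have bdd : ∀ {K : X × Y → ℝ≥0}, (∀ w, K w ≤ 1) → ∫⁻ w, K w ∂μ ≠ ∞ := by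
    intro K hK
    refine ne_top_of_le_ne_top ENNReal.one_ne_top
      ((lintegral_mono fun w => ENNReal.coe_le_coe.2 (hK w)).trans ?_)
    simp
  have key := map_withDensity_eq_of_tendsto hp hz hconv hPnμ hPμ hF hG
    (bdd fun w => Set.indicator_le' (fun _ _ => le_rfl) (fun _ _ => zero_le_one) w)
    (bdd fun w => Set.indicator_le' (f := fun y => ((μ.map Prod.swap).condKernel y A).toNNReal)
      (g := 1) (fun y _ => ENNReal.toNNReal_mono ENNReal.one_ne_top prob_le_one)
      (fun _ _ => zero_le_one) w.2)
    (fun n => by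
      ext D hD
      rw [map_withDensity_indicator_apply _ hA hB hD,
        map_withDensity_condKernel_apply μ (κ n) (hPn_snd n) hA hB hD, hPn n A B D hA hB hD])
  rw [← map_withDensity_indicator_apply _ hA hB hC, key,
    map_withDensity_condKernel_apply μ _ hP_snd hA hB hC]
end

section
/- Let X be a Polish space, Y a nonempty compact metric space, and μ a Borel probability measure on X × Y. Consider the set Kμ := { ν : ν is a Borel probability measure on X × Y such that there exists a Markov kernel κ from Y to Y with ν(A × B) = ∫_{A×Y} κ(y)(B) μ(dx,dy) for all Borel A ⊆ X, B ⊆ Y } of all garblings of μ. Then Kμ is compact in the topology of weak convergence of probability measures on X × Y, and Kμ is closed under convex combinations: if ν₁, ν₂ ∈ Kμ and θ ∈ [0,1], then θ·ν₁ + (1−θ)·ν₂ ∈ Kμ. -/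
open MeasureTheory ProbabilityTheory NNReal
open scoped ENNReal BoundedContinuousFunction Topology

/-- On the probability measures with a prescribed first marginal, testing against the product of an
integrable function of the first coordinate and a bounded continuous function of the second
coordinate is weakly continuous. -/
lemma continuousOn_integral_mul_of_map_fst
    {Z W : Type*} [TopologicalSpace Z] [NormalSpace Z] [MeasurableSpace Z] [BorelSpace Z]
    [TopologicalSpace W] [MeasurableSpace W] [BorelSpace W]
    [OpensMeasurableSpace (Z × W)]
    (μ : Measure Z) [μ.WeaklyRegular] {f : Z → ℝ} (hf : Integrable f μ) (h : W →ᵇ ℝ) :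
    ContinuousOn (fun π : ProbabilityMeasure (Z × W) ↦
        ∫ p, f p.1 * h p.2 ∂(π : Measure (Z × W)))
      {π | (π : Measure (Z × W)).map Prod.fst = μ} := by
  refine continuousOn_of_uniform_approx_of_continuousOn fun u hu ↦ ?_
  obtain ⟨ε, hε, hεu⟩ := Metric.mem_uniformity_dist.1 hu
  have hpos : 0 < ‖h‖ + 1 := by positivity
  obtain ⟨g, hg, hgi⟩ := hf.exists_boundedContinuous_integral_sub_le
    (ε := ε / 2 / (‖h‖ + 1)) (by positivity)
  let G : (Z × W) →ᵇ ℝ := g.compContinuous ⟨Prod.fst, continuous_fst⟩ *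
    h.compContinuous ⟨Prod.snd, continuous_snd⟩
  refine ⟨fun π ↦ ∫ p, G p ∂(π : Measure (Z × W)),
    (ProbabilityMeasure.continuous_integral_boundedContinuousFunction G).continuousOn,
    fun π hπ ↦ hεu ?_⟩
  have hπ' : (π : Measure (Z × W)).map Prod.fst = μ := hπ
  have hmp : MeasurePreserving (Prod.fst : Z × W → Z) (π : Measure (Z × W)) μ :=
    ⟨measurable_fst, hπ'⟩
  have hh : AEStronglyMeasurable (fun p : Z × W ↦ h p.2) (π : Measure (Z × W)) :=
    (h.continuous.measurable.comp measurable_snd).aestronglyMeasurable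
  have hfh : Integrable (fun p : Z × W ↦ f p.1 * h p.2) (π : Measure (Z × W)) :=
    (hmp.integrable_comp_of_integrable hf).mul_bdd hh (.of_forall fun p ↦ h.norm_coe_le_norm p.2)
  have hgh : Integrable (fun p : Z × W ↦ g p.1 * h p.2) (π : Measure (Z × W)) :=
    (hmp.integrable_comp_of_integrable hgi).mul_bdd hh (.of_forall fun p ↦ h.norm_coe_le_norm p.2)
  have hfg : Integrable (fun z ↦ ‖f z - g z‖) μ := (hf.sub hgi).norm
  have hcomp : ∫ p : Z × W, ‖f p.1 - g p.1‖ ∂(π : Measure (Z × W)) = ∫ z, ‖f z - g z‖ ∂μ := by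
    rw [← hπ', integral_map measurable_fst.aemeasurable (by rw [hπ']; exact hfg.1)]
  have hG : ∫ p, G p ∂(π : Measure (Z × W)) = ∫ p, g p.1 * h p.2 ∂(π : Measure (Z × W)) := rfl
  simp only [hG]
  rw [dist_eq_norm, ← integral_sub hfh hgh]
  calc ‖∫ p, (f p.1 * h p.2 - g p.1 * h p.2) ∂(π : Measure (Z × W))‖
      ≤ ∫ p, ‖f p.1 - g p.1‖ * ‖h‖ ∂(π : Measure (Z × W)) := by
        refine norm_integral_le_of_norm_le
          ((hmp.integrable_comp_of_integrable hfg).mul_const _) (.of_forall fun p ↦ ?_)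
        rw [← sub_mul, norm_mul]
        gcongr
        exact h.norm_coe_le_norm p.2
    _ = (∫ z, ‖f z - g z‖ ∂μ) * ‖h‖ := by rw [integral_mul_const, hcomp]
    _ ≤ (ε / 2 / (‖h‖ + 1)) * (‖h‖ + 1) := by
        gcongr
        linarith
    _ < ε := by
        rw [div_mul_cancel₀ _ hpos.ne']
        linarith

/-- The probability measures on a product with a compact second factor that have a prescribed tight
first marginal form a weakly compact set. -/
lemma isCompact_setOf_map_fst_eq
    {Z W : Type*} [TopologicalSpace Z] [PolishSpace Z] [MeasurableSpace Z] [BorelSpace Z]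
    [TopologicalSpace W] [PolishSpace W] [CompactSpace W] [MeasurableSpace W] [BorelSpace W]
    (μ : Measure Z) [IsProbabilityMeasure μ] :
    IsCompact {π : ProbabilityMeasure (Z × W) | (π : Measure (Z × W)).map Prod.fst = μ} := by
  have hclosed :
      IsClosed {π : ProbabilityMeasure (Z × W) | (π : Measure (Z × W)).map Prod.fst = μ} := by
    let _ := TopologicalSpace.upgradeIsCompletelyMetrizable Z
    let μ' : ProbabilityMeasure Z := ⟨μ, inferInstance⟩
    have : {π : ProbabilityMeasure (Z × W) | (π : Measure (Z × W)).map Prod.fst = μ} =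
        (fun π : ProbabilityMeasure (Z × W) ↦ π.map measurable_fst.aemeasurable) ⁻¹' {μ'} := by
      ext π
      exact ⟨fun h ↦ Subtype.ext h, fun h ↦ congrArg Subtype.val (Set.mem_singleton_iff.1 h)⟩
    rw [this]
    exact isClosed_singleton.preimage (ProbabilityMeasure.continuous_map continuous_fst)
  rw [← hclosed.closure_eq]
  refine isCompact_closure_of_isTightMeasureSet (IsTightMeasureSet.prodMk ?_ .of_compactSpace)
  refine (isTightMeasureSet_singleton (μ := μ)).subset ?_
  rintro _ ⟨_, ⟨π, hπ, rfl⟩, rfl⟩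
  exact hπ

/-- Integrating a function of the second coordinate over a strip, through a disintegration along
the second coordinate. -/
lemma setLIntegral_prod_univ_eq_lintegral_mul
    {X Y : Type*} [MeasurableSpace X] [MeasurableSpace Y]
    {μ : Measure (X × Y)} [IsFiniteMeasure μ] {η : Kernel Y X} [IsMarkovKernel η]
    (hη : μ.snd ⊗ₘ η = μ.map Prod.swap) {A : Set X} (hA : MeasurableSet A)
    {f : Y → ℝ≥0∞} (hf : Measurable f) :
    ∫⁻ p in A ×ˢ Set.univ, f p.2 ∂μ = ∫⁻ p, η p.2 A * f p.2 ∂μ := by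
  have hηA : Measurable fun y ↦ η y A := η.measurable_coe hA
  calc ∫⁻ p in A ×ˢ Set.univ, f p.2 ∂μ
      = ∫⁻ q in Set.univ ×ˢ A, f q.1 ∂(μ.map Prod.swap) := by
        rw [setLIntegral_map (MeasurableSet.univ.prod hA) (by fun_prop) measurable_swap]
        congr 2
        ext p
        simp
    _ = ∫⁻ y, η y A * f y ∂μ.snd := by
        rw [← hη, Measure.setLIntegral_compProd (by fun_prop) .univ hA, setLIntegral_univ]
        simp [mul_comm]
    _ = ∫⁻ p, η p.2 A * f p.2 ∂μ := by
        rw [Measure.snd, lintegral_map (by fun_prop) measurable_snd]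

/-- Laws `π` of triples `(x, y, y')` with `(x, y)` distributed according to `μ` for which `x` and
`y'` are conditionally independent given `y`, where `η` is a conditional law of `x` given `y`. -/
def conditionallyIndependentCouplings
    {X Y : Type*} [MeasurableSpace X] [MeasurableSpace Y]
    (μ : Measure (X × Y)) (η : Kernel Y X) : Set (ProbabilityMeasure ((X × Y) × Y)) :=
  {π | (π : Measure ((X × Y) × Y)).map Prod.fst = μ ∧
    ∀ A : Set X, MeasurableSet A → ∀ B : Set Y, MeasurableSet B →
      (π : Measure ((X × Y) × Y)) ((A ×ˢ Set.univ) ×ˢ B) =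
        ∫⁻ q in Set.univ ×ˢ B, η q.1.2 A ∂(π : Measure ((X × Y) × Y))}

/-- Conditional independence can be tested against bounded continuous functions. -/
lemma forall_measure_eq_setLIntegral_iff_forall_integral_eq_zero
    {X Y W : Type*} [MeasurableSpace X] [MeasurableSpace Y] [TopologicalSpace W]
    [HasOuterApproxClosed W] [MeasurableSpace W] [BorelSpace W]
    (π : Measure ((X × Y) × W)) [IsFiniteMeasure π] (η : Kernel Y X) [IsMarkovKernel η]
    {A : Set X} (hA : MeasurableSet A) :
    (∀ B : Set W, MeasurableSet B →
        π ((A ×ˢ Set.univ) ×ˢ B) = ∫⁻ q in Set.univ ×ˢ B, η q.1.2 A ∂π) ↔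
      ∀ h : W →ᵇ ℝ, ∫ q,
        ((A ×ˢ (Set.univ : Set Y)).indicator 1 q.1 - (η q.1.2 A).toReal) * h q.2 ∂π = 0 := by
  have hS : MeasurableSet (A ×ˢ (Set.univ : Set Y)) := hA.prod .univ
  have hηA : Measurable fun q : (X × Y) × W ↦ η q.1.2 A :=
    (η.measurable_coe hA).comp (by fun_prop)
  have hS' : MeasurableSet ((Prod.fst : (X × Y) × W → X × Y) ⁻¹' (A ×ˢ Set.univ)) :=
    measurable_fst hS
  set m₁ := (π.restrict (Prod.fst ⁻¹' (A ×ˢ Set.univ))).map Prod.snd with hm₁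
  set m₂ := (π.withDensity fun q ↦ η q.1.2 A).map Prod.snd with hm₂
  have hfin : IsFiniteMeasure (π.withDensity fun q ↦ η q.1.2 A) := by
    refine isFiniteMeasure_withDensity (ne_of_lt ?_)
    calc ∫⁻ q, η q.1.2 A ∂π ≤ ∫⁻ _, 1 ∂π := lintegral_mono fun q ↦ prob_le_one
      _ < ∞ := by simp
  have hsets : (∀ B : Set W, MeasurableSet B →
        π ((A ×ˢ Set.univ) ×ˢ B) = ∫⁻ q in Set.univ ×ˢ B, η q.1.2 A ∂π) ↔ m₁ = m₂ := by
    rw [Measure.ext_iff]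
    refine forall₂_congr fun B hB ↦ ?_
    rw [hm₁, hm₂, Measure.map_apply measurable_snd hB, Measure.map_apply measurable_snd hB,
      Measure.restrict_apply (measurable_snd hB), withDensity_apply _ (measurable_snd hB),
      Set.univ_prod, Set.prod_eq, Set.inter_comm]
  have hint₁ (h : W →ᵇ ℝ) :
      Integrable (fun q ↦ (A ×ˢ (Set.univ : Set Y)).indicator (1 : X × Y → ℝ) q.1 * h q.2) π := by
    refine Integrable.mul_bdd (c := ‖h‖) ?_ ?_ (.of_forall fun q ↦ h.norm_coe_le_norm q.2)
    · exact (integrable_const (1 : ℝ)).indicator hS'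
    · exact (h.continuous.measurable.comp measurable_snd).aestronglyMeasurable
  have hint₂ (h : W →ᵇ ℝ) : Integrable (fun q ↦ (η q.1.2 A).toReal * h q.2) π := by
    refine Integrable.mul_bdd (c := ‖h‖) ?_ ?_ (.of_forall fun q ↦ h.norm_coe_le_norm q.2)
    · refine Integrable.of_bound hηA.ennreal_toReal.aestronglyMeasurable 1 (.of_forall fun q ↦ ?_)
      exact (Real.norm_of_nonneg ENNReal.toReal_nonneg).trans_le
        (measureReal_le_one (μ := η q.1.2) (s := A))
    · exact (h.continuous.measurable.comp measurable_snd).aestronglyMeasurable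
  have heq₁ (h : W →ᵇ ℝ) : ∫ w, h w ∂m₁ =
      ∫ q, (A ×ˢ (Set.univ : Set Y)).indicator (1 : X × Y → ℝ) q.1 * h q.2 ∂π := by
    rw [hm₁, integral_map measurable_snd.aemeasurable
      h.continuous.measurable.aestronglyMeasurable, ← integral_indicator hS']
    congr with q
    by_cases hq : q.1 ∈ A ×ˢ (Set.univ : Set Y) <;> simp [Set.indicator, hq]
  have heq₂ (h : W →ᵇ ℝ) : ∫ w, h w ∂m₂ = ∫ q, (η q.1.2 A).toReal * h q.2 ∂π := by
    rw [hm₂, integral_map measurable_snd.aemeasurable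
      h.continuous.measurable.aestronglyMeasurable,
      integral_withDensity_eq_integral_toReal_smul hηA (.of_forall fun q ↦ measure_lt_top _ _)]
    rfl
  have hdiff (h : W →ᵇ ℝ) :
      ∫ q, ((A ×ˢ (Set.univ : Set Y)).indicator 1 q.1 - (η q.1.2 A).toReal) * h q.2 ∂π =
        ∫ w, h w ∂m₁ - ∫ w, h w ∂m₂ := by
    rw [heq₁, heq₂, ← integral_sub (hint₁ h) (hint₂ h)]
    simp only [sub_mul]
  simp only [hsets, hdiff, sub_eq_zero]
  exact ⟨fun hm h ↦ by rw [hm], ext_of_forall_integral_eq_of_IsFiniteMeasure⟩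

lemma isCompact_conditionallyIndependentCouplings
    {X Y : Type*} [TopologicalSpace X] [PolishSpace X] [MeasurableSpace X] [BorelSpace X]
    [TopologicalSpace Y] [PolishSpace Y] [CompactSpace Y] [MeasurableSpace Y] [BorelSpace Y]
    (μ : Measure (X × Y)) [IsProbabilityMeasure μ] (η : Kernel Y X) [IsMarkovKernel η] :
    IsCompact (conditionallyIndependentCouplings μ η) := by
  let _ := TopologicalSpace.upgradeIsCompletelyMetrizable X
  let _ := TopologicalSpace.upgradeIsCompletelyMetrizable Y
  set s : Set (ProbabilityMeasure ((X × Y) × Y)) :=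
    {π | (π : Measure ((X × Y) × Y)).map Prod.fst = μ}
  have hs : IsCompact s := isCompact_setOf_map_fst_eq μ
  have heq : conditionallyIndependentCouplings μ η =
      s ∩ ⋂ (A : {A : Set X // MeasurableSet A}) (h : Y →ᵇ ℝ),
        (s ∩ (fun π : ProbabilityMeasure ((X × Y) × Y) ↦
          ∫ q, ((A.1 ×ˢ (Set.univ : Set Y)).indicator 1 q.1 - (η q.1.2 A.1).toReal) * h q.2
            ∂(π : Measure ((X × Y) × Y))) ⁻¹' {0}) := by
    ext π
    simp only [conditionallyIndependentCouplings, Set.mem_inter_iff, Set.mem_iInter,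
      Set.mem_preimage, Set.mem_singleton_iff, Subtype.forall]
    refine and_congr_right fun hπ ↦ forall₂_congr fun A hA ↦ ?_
    rw [forall_measure_eq_setLIntegral_iff_forall_integral_eq_zero _ η hA]
    exact forall_congr' fun h ↦ ⟨fun h0 ↦ ⟨hπ, h0⟩, fun h0 ↦ h0.2⟩
  rw [heq]
  refine hs.inter_right (isClosed_iInter fun A ↦ isClosed_iInter fun h ↦ ?_)
  refine ContinuousOn.preimage_isClosed_of_isClosed ?_ hs.isClosed isClosed_singleton
  refine continuousOn_integral_mul_of_map_fst μ
    (f := fun z ↦ (A.1 ×ˢ (Set.univ : Set Y)).indicator 1 z - (η z.2 A.1).toReal) ?_ h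
  refine Integrable.sub ((integrable_const (1 : ℝ)).indicator (A.2.prod .univ)) ?_
  refine Integrable.of_bound (((η.measurable_coe A.2).comp
    measurable_snd).ennreal_toReal.aestronglyMeasurable) 1 (.of_forall fun z ↦ ?_)
  exact (Real.norm_of_nonneg ENNReal.toReal_nonneg).trans_le
    (measureReal_le_one (μ := η z.2) (s := A.1))

/-- A joint law of `(x, y')` is a garbling exactly when it is the law of `(x, y')` under some
conditionally independent coupling. -/
lemma exists_kernel_iff_mem_image_conditionallyIndependentCouplings
    {X Y : Type*} [MeasurableSpace X] [MeasurableSpace Y] [StandardBorelSpace Y] [Nonempty Y]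
    {μ : Measure (X × Y)} [IsProbabilityMeasure μ] {η : Kernel Y X} [IsMarkovKernel η]
    (hη : μ.snd ⊗ₘ η = μ.map Prod.swap) (ν : ProbabilityMeasure (X × Y)) :
    (∃ κ : Kernel Y Y, IsMarkovKernel κ ∧
      ∀ (A : Set X) (B : Set Y), MeasurableSet A → MeasurableSet B →
        (ν : Measure (X × Y)) (A ×ˢ B) = ∫⁻ p in A ×ˢ (Set.univ : Set Y), κ p.2 B ∂μ) ↔
    ν ∈ (fun π : ProbabilityMeasure ((X × Y) × Y) ↦
        π.map (f := fun q ↦ (q.1.1, q.2)) (Measurable.aemeasurable (by fun_prop))) ''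
      conditionallyIndependentCouplings μ η := by
  have hf : Measurable fun q : (X × Y) × Y ↦ (q.1.1, q.2) := by fun_prop
  have hpre (A : Set X) (B : Set Y) :
      (fun q : (X × Y) × Y ↦ (q.1.1, q.2)) ⁻¹' (A ×ˢ B) = (A ×ˢ Set.univ) ×ˢ B := by
    ext q
    simp
  constructor
  · rintro ⟨κ, hκ, hν⟩
    let κ' : Kernel (X × Y) Y := κ.comap Prod.snd measurable_snd
    have hrect (A : Set X) (hA : MeasurableSet A) (B : Set Y) (hB : MeasurableSet B) :
        (μ ⊗ₘ κ') ((A ×ˢ Set.univ) ×ˢ B) = ∫⁻ p in A ×ˢ Set.univ, κ p.2 B ∂μ := by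
      rw [Measure.compProd_apply_prod (hA.prod .univ) hB]
      rfl
    let π : ProbabilityMeasure ((X × Y) × Y) := ⟨μ ⊗ₘ κ', inferInstance⟩
    have hπ : (π : Measure ((X × Y) × Y)) = μ ⊗ₘ κ' := rfl
    refine ⟨π, ⟨Measure.fst_compProd μ κ', fun A hA B hB ↦ ?_⟩, ?_⟩
    · have hηA : Measurable fun q : (X × Y) × Y ↦ η q.1.2 A :=
        (η.measurable_coe hA).comp (by fun_prop)
      rw [hπ, hrect A hA B hB, setLIntegral_prod_univ_eq_lintegral_mul hη hA (κ.measurable_coe hB),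
        Measure.setLIntegral_compProd hηA .univ hB]
      simp [κ', Kernel.comap_apply]
    · refine ProbabilityMeasure.toMeasure_injective
        (Measure.ext_prod (μ := (ν : Measure (X × Y))) fun {A B} hA hB ↦ ?_).symm
      beta_reduce
      rw [ProbabilityMeasure.toMeasure_map _ hf.aemeasurable,
        Measure.map_apply hf (hA.prod hB), hpre, hν A B hA hB, hπ, hrect A hA B hB]
  · rintro ⟨π, ⟨hfst, hπ⟩, rfl⟩
    have hg : Measurable fun q : (X × Y) × Y ↦ (q.1.2, q.2) := by fun_prop
    set lam : Measure (Y × Y) := (π : Measure ((X × Y) × Y)).map fun q ↦ (q.1.2, q.2) with hlam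
    have : IsProbabilityMeasure lam := Measure.isProbabilityMeasure_map hg.aemeasurable
    have hlam_fst : lam.fst = μ.snd := by
      rw [hlam, Measure.fst, Measure.map_map measurable_fst hg, Measure.snd, ← hfst,
        Measure.map_map measurable_snd measurable_fst]
      rfl
    refine ⟨lam.condKernel, inferInstance, fun A B hA hB ↦ ?_⟩
    have hηA : Measurable fun y ↦ η y A := η.measurable_coe hA
    have hκB : Measurable fun y ↦ lam.condKernel y B := lam.condKernel.measurable_coe hB
    rw [ProbabilityMeasure.toMeasure_map _ hf.aemeasurable, Measure.map_apply hf (hA.prod hB),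
      hpre, hπ A hA B hB]
    calc ∫⁻ q in Set.univ ×ˢ B, η q.1.2 A ∂(π : Measure ((X × Y) × Y))
        = ∫⁻ r in Set.univ ×ˢ B, η r.1 A ∂lam := by
          rw [hlam, setLIntegral_map (MeasurableSet.univ.prod hB) (by fun_prop) hg]
          congr 2
      _ = ∫⁻ y, η y A * lam.condKernel y B ∂μ.snd := by
          conv_lhs => rw [← lam.disintegrate lam.condKernel]
          rw [Measure.setLIntegral_compProd (by fun_prop) .univ hB, setLIntegral_univ, hlam_fst]
          simp only [setLIntegral_const]
      _ = ∫⁻ p, η p.2 A * lam.condKernel p.2 B ∂μ := by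
          rw [Measure.snd, lintegral_map (by fun_prop) measurable_snd]
      _ = ∫⁻ p in A ×ˢ Set.univ, lam.condKernel p.2 B ∂μ :=
          (setLIntegral_prod_univ_eq_lintegral_mul hη hA hκB).symm

/-- Markov kernels are closed under pointwise convex combinations. -/
lemma exists_isMarkovKernel_eq_smul_add_smul
    {α β : Type*} [MeasurableSpace α] [MeasurableSpace β] (κ₁ κ₂ : Kernel α β)
    [IsMarkovKernel κ₁] [IsMarkovKernel κ₂] {θ : ℝ≥0} (hθ : θ ≤ 1) :
    ∃ κ : Kernel α β, IsMarkovKernel κ ∧ ∀ a, κ a = θ • κ₁ a + (1 - θ) • κ₂ a := by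
  refine ⟨⟨fun a ↦ θ • κ₁ a + (1 - θ) • κ₂ a,
    Measure.measurable_of_measurable_coe _ fun s hs ↦ ?_⟩, ⟨fun a ↦ ⟨?_⟩⟩, fun a ↦ rfl⟩
  · have h₁ := κ₁.measurable_coe hs
    have h₂ := κ₂.measurable_coe hs
    simp only [Measure.coe_add, Pi.add_apply, Measure.smul_apply]
    fun_prop
  · change (θ • κ₁ a + (1 - θ) • κ₂ a) Set.univ = 1
    simp only [Measure.coe_add, Pi.add_apply, Measure.smul_apply, measure_univ,
      ENNReal.smul_def, smul_eq_mul, mul_one]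
    rw [← ENNReal.coe_add, add_tsub_cancel_of_le hθ, ENNReal.coe_one]

/-- The set `Kμ` of all garblings of an information structure `μ` on `X × Y`
(with `X` Polish and `Y` a nonempty compact metric space) is compact in the topology of
weak convergence and is closed under convex combinations. -/
theorem garblings_compact_convex
    {X Y : Type*} [MetricSpace X] [PolishSpace X] [MeasurableSpace X] [BorelSpace X]
    [MetricSpace Y] [CompactSpace Y] [Nonempty Y] [MeasurableSpace Y] [BorelSpace Y]
    (μ : Measure (X × Y)) [IsProbabilityMeasure μ]
    (Kμ : Set (ProbabilityMeasure (X × Y)))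
    (hKμ : Kμ = {ν : ProbabilityMeasure (X × Y) | ∃ κ : Kernel Y Y, IsMarkovKernel κ ∧
      ∀ (A : Set X) (B : Set Y), MeasurableSet A → MeasurableSet B →
        (ν : Measure (X × Y)) (A ×ˢ B) = ∫⁻ p in A ×ˢ (Set.univ : Set Y), κ p.2 B ∂μ}) :
    IsCompact Kμ ∧
      ∀ ν₁ ∈ Kμ, ∀ ν₂ ∈ Kμ, ∀ θ : ℝ≥0, θ ≤ 1 →
        ∀ ν : ProbabilityMeasure (X × Y),
          (ν : Measure (X × Y)) =
            θ • (ν₁ : Measure (X × Y)) + ((1 : ℝ≥0) - θ) • (ν₂ : Measure (X × Y)) →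
          ν ∈ Kμ := by
  subst hKμ
  refine ⟨?_, ?_⟩
  · have : Nonempty X := (Measure.nonempty_of_neZero μ).map Prod.fst
    have : IsProbabilityMeasure (μ.map Prod.swap) :=
      Measure.isProbabilityMeasure_map measurable_swap.aemeasurable
    have hη : μ.snd ⊗ₘ (μ.map Prod.swap).condKernel = μ.map Prod.swap := by
      rw [← Measure.fst_map_swap, Measure.disintegrate]
    simp only [exists_kernel_iff_mem_image_conditionallyIndependentCouplings hη, Set.ofPred_mem_eq]
    exact (isCompact_conditionallyIndependentCouplings μ _).image
      (ProbabilityMeasure.continuous_map (by fun_prop))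
  · rintro ν₁ ⟨κ₁, hκ₁, hν₁⟩ ν₂ ⟨κ₂, hκ₂, hν₂⟩ θ hθ ν hν
    obtain ⟨κ, hκ, hκeq⟩ := exists_isMarkovKernel_eq_smul_add_smul κ₁ κ₂ hθ
    refine ⟨κ, hκ, fun A B hA hB ↦ ?_⟩
    have h₁ : Measurable fun p : X × Y ↦ κ₁ p.2 B :=
      (κ₁.measurable_coe hB).comp measurable_snd
    have h₂ : Measurable fun p : X × Y ↦ κ₂ p.2 B :=
      (κ₂.measurable_coe hB).comp measurable_snd
    simp only [hν, hκeq, Measure.coe_add, Pi.add_apply, Measure.smul_apply, hν₁ A B hA hB,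
      hν₂ A B hA hB, ENNReal.smul_def, smul_eq_mul]
    rw [lintegral_add_left (h₁.const_mul _), lintegral_const_mul _ h₁, lintegral_const_mul _ h₂]
end

section
/- Let Y and U be Polish spaces and Q̄ a Borel probability measure on Y. Let (P_n) and P be Borel probability measures on Y × U, each having Y-marginal equal to Q̄, and suppose P_n converges weakly to P. Then for every bounded jointly measurable function c : Y × U → ℝ such that u ↦ c(y,u) is continuous for every y ∈ Y, one has ∫_{Y×U} c dP_n → ∫_{Y×U} c dP. In other words, on the set of probability measures on Y × U with a fixed Y-marginal, weak convergence implies convergence of integrals of all bounded Carathéodory integrands (weak convergence coincides with w-s convergence). -/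
open MeasureTheory Filter

universe u v

/-- For probability measures on `Y × U` with a common `Y`-marginal, the open-set inequality of the
portmanteau theorem holds for countable unions of rectangles with measurable first side and open
second side. -/
theorem le_liminf_measure_iUnion_prod_of_fst_eq
    {Y U ι : Type*} [TopologicalSpace Y] [MeasurableSpace Y] [OpensMeasurableSpace Y]
    [TopologicalSpace U] [MeasurableSpace U] [OpensMeasurableSpace (Y × U)]
    [HasOuterApproxClosed (Y × U)] [Countable ι]
    {Q : Measure Y} [IsFiniteMeasure Q] [Q.OuterRegular]
    {μs : ℕ → ProbabilityMeasure (Y × U)} {μ : ProbabilityMeasure (Y × U)}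
    (hμs : ∀ n, (μs n : Measure (Y × U)).map Prod.fst = Q)
    (hlim : Tendsto μs atTop (nhds μ))
    {A : ι → Set Y} (hA : ∀ i, MeasurableSet (A i)) {B : ι → Set U} (hB : ∀ i, IsOpen (B i)) :
    (μ : Measure (Y × U)) (⋃ i, A i ×ˢ B i) ≤
      liminf (fun n => (μs n : Measure (Y × U)) (⋃ i, A i ×ˢ B i)) atTop := by
  refine ENNReal.le_of_forall_pos_le_add fun ε hε _ => ?_
  obtain ⟨δ, hδ, hδε⟩ :=
    ENNReal.exists_pos_sum_of_countable' (ENNReal.coe_ne_zero.2 hε.ne') ι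
  choose O hAO hO _ hOδ using fun i =>
    (hA i).exists_isOpen_sdiff_lt (measure_ne_top Q (A i)) (hδ i).ne'
  have hmeas : MeasurableSet (⋃ i, O i \ A i) :=
    .iUnion fun i => (hO i).measurableSet.diff (hA i)
  have hsmall : Q (⋃ i, O i \ A i) ≤ ε :=
    (measure_iUnion_le _).trans <| (ENNReal.tsum_le_tsum fun i => (hOδ i).le).trans hδε.le
  have hle (n : ℕ) : (μs n : Measure (Y × U)) (⋃ i, O i ×ˢ B i) ≤
      (μs n : Measure (Y × U)) (⋃ i, A i ×ˢ B i) + ε := by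
    have hsub : (⋃ i, O i ×ˢ B i) ⊆
        (⋃ i, A i ×ˢ B i) ∪ Prod.fst ⁻¹' (⋃ i, O i \ A i) := by
      rintro ⟨y, u⟩ h
      simp only [Set.mem_iUnion, Set.mem_prod, Set.mem_union, Set.mem_preimage,
        Set.mem_sdiff] at h ⊢
      obtain ⟨i, hy, hu⟩ := h
      by_cases hyA : y ∈ A i
      · exact .inl ⟨i, hyA, hu⟩
      · exact .inr ⟨i, hy, hyA⟩
    refine (measure_mono hsub).trans <| (measure_union_le _ _).trans ?_
    gcongr
    rw [← Measure.map_apply measurable_fst hmeas, hμs n]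
    exact hsmall
  calc (μ : Measure (Y × U)) (⋃ i, A i ×ˢ B i)
      ≤ (μ : Measure (Y × U)) (⋃ i, O i ×ˢ B i) :=
        measure_mono <| Set.iUnion_mono fun i => Set.prod_mono_left (hAO i)
    _ ≤ liminf (fun n => (μs n : Measure (Y × U)) (⋃ i, O i ×ˢ B i)) atTop :=
        ProbabilityMeasure.le_liminf_measure_open_of_tendsto hlim
          (isOpen_iUnion fun i => (hO i).prod (hB i))
    _ ≤ liminf (fun n => (μs n : Measure (Y × U)) (⋃ i, A i ×ˢ B i) + ε) atTop :=
        liminf_le_liminf (.of_forall hle)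
    _ = liminf (fun n => (μs n : Measure (Y × U)) (⋃ i, A i ×ˢ B i)) atTop + ε :=
        liminf_add_const _ _ _ (by isBoundedDefault) (by isBoundedDefault)

/-- The preimage of an open set under a Carathéodory function is a countable union of rectangles
with measurable first side and open second side. -/
theorem exists_preimage_eq_iUnion_prod_of_continuous
    {Y : Type*} {U : Type u} {Z : Type v} [MeasurableSpace Y] [TopologicalSpace U]
    [SecondCountableTopology U] [TopologicalSpace Z] [SecondCountableTopology Z] [RegularSpace Z]
    [MeasurableSpace Z] [OpensMeasurableSpace Z] {c : Y → U → Z}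
    (hmeas : ∀ u, Measurable fun y => c y u) (hcont : ∀ y, Continuous (c y))
    {G : Set Z} (hG : IsOpen G) :
    ∃ (ι : Type (max u v)) (_ : Countable ι) (A : ι → Set Y) (B : ι → Set U),
      (∀ i, MeasurableSet (A i)) ∧ (∀ i, IsOpen (B i)) ∧
        (fun p : Y × U => c p.1 p.2) ⁻¹' G = ⋃ i, A i ×ˢ B i := by
  obtain ⟨D, hDc, hD⟩ := TopologicalSpace.exists_countable_dense U
  let 𝒱 : Set (Set Z) := {V ∈ TopologicalSpace.countableBasis Z | closure V ⊆ G}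
  have h𝒱 : Countable 𝒱 :=
    ((TopologicalSpace.countable_countableBasis Z).mono fun _ h => h.1).to_subtype
  refine ⟨TopologicalSpace.countableBasis U × 𝒱, inferInstance,
    fun i => ⋂ v ∈ D ∩ i.1, (c · v) ⁻¹' closure (i.2 : Set Z), fun i => i.1,
    fun i => .biInter (hDc.mono Set.inter_subset_left) fun v _ =>
      hmeas v isClosed_closure.measurableSet,
    fun i => TopologicalSpace.isOpen_of_mem_countableBasis i.1.2, ?_⟩
  ext ⟨y, u⟩
  simp only [Set.mem_preimage, Set.mem_iUnion, Set.mem_prod, Set.mem_iInter]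
  constructor
  · intro h
    obtain ⟨V, hV, hcV, hVG⟩ :=
      (TopologicalSpace.isBasis_countableBasis Z).exists_closure_subset (hG.mem_nhds h)
    have hVo := TopologicalSpace.isOpen_of_mem_countableBasis hV
    obtain ⟨W, hW, huW, hWV⟩ :=
      (TopologicalSpace.isBasis_countableBasis U).exists_subset_of_mem_open
        (show u ∈ c y ⁻¹' V from hcV) (hVo.preimage (hcont y))
    exact ⟨(⟨W, hW⟩, ⟨V, hV, hVG⟩), fun v hv => subset_closure (hWV hv.2), huW⟩
  · rintro ⟨⟨⟨W, hW⟩, ⟨V, _, hVG⟩⟩, hy, hu⟩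
    have hWo := TopologicalSpace.isOpen_of_mem_countableBasis hW
    have hsub : W ∩ D ⊆ c y ⁻¹' closure V := fun v hv => hy v hv.symm
    exact hVG <| closure_minimal hsub (isClosed_closure.preimage (hcont y))
      (hD.open_subset_closure_inter hWo hu)

/-- On the set of probability measures on `Y × U` with a fixed `Y`-marginal
`Q̄`, weak convergence implies convergence of integrals of all bounded Carathéodory
integrands (i.e. weak convergence coincides with w-s convergence). -/
theorem weak_convergence_fixed_marginal_caratheodory
    {Y U : Type*} [MetricSpace Y] [PolishSpace Y] [MeasurableSpace Y] [BorelSpace Y]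
    [MetricSpace U] [PolishSpace U] [MeasurableSpace U] [BorelSpace U]
    (Qbar : Measure Y) [IsProbabilityMeasure Qbar]
    (Pn : ℕ → ProbabilityMeasure (Y × U)) (P : ProbabilityMeasure (Y × U))
    (hPn : ∀ n, (Pn n : Measure (Y × U)).map Prod.fst = Qbar)
    (hP : (P : Measure (Y × U)).map Prod.fst = Qbar)
    (hconv : Tendsto Pn atTop (nhds P))
    (c : Y → U → ℝ)
    (hbdd : ∃ M : ℝ, ∀ y u, |c y u| ≤ M)
    (hmeas : Measurable fun p : Y × U => c p.1 p.2)
    (hcont : ∀ y, Continuous fun u : U => c y u) :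
    Tendsto (fun n => ∫ p : Y × U, c p.1 p.2 ∂(Pn n : Measure (Y × U))) atTop
      (nhds (∫ p : Y × U, c p.1 p.2 ∂(P : Measure (Y × U)))) := by
  obtain ⟨M, hM⟩ := hbdd
  have hlaw : Tendsto (fun n => (Pn n).map hmeas.aemeasurable) atTop
      (nhds (P.map hmeas.aemeasurable)) := by
    refine tendsto_of_forall_isOpen_le_liminf' fun G hG => ?_
    obtain ⟨ι, _, A, B, hA, hB, hAB⟩ := exists_preimage_eq_iUnion_prod_of_continuous (c := c)
      (fun u => hmeas.comp measurable_prodMk_right) hcont hG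
    simp only [ProbabilityMeasure.toMeasure_map, Measure.map_apply hmeas hG.measurableSet]
    simpa only [← hAB] using le_liminf_measure_iUnion_prod_of_fst_eq hPn hconv hA hB
  let φ : BoundedContinuousFunction ℝ ℝ :=
    .ofNormedAddCommGroup (fun x => max (-|M|) (min x |M|)) (by fun_prop) |M| fun x =>
      abs_le.2 ⟨le_max_left _ _, max_le (neg_le_self (abs_nonneg M)) (min_le_right _ _)⟩
  have hφ (y : Y) (u : U) : φ (c y u) = c y u := by
    obtain ⟨h₁, h₂⟩ := abs_le.1 ((hM y u).trans (le_abs_self M))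
    change max (-|M|) (min (c y u) |M|) = c y u
    rw [min_eq_left h₂, max_eq_right h₁]
  have hint (μ : ProbabilityMeasure (Y × U)) :
      ∫ x, φ x ∂(μ.map hmeas.aemeasurable : Measure ℝ) =
        ∫ p : Y × U, c p.1 p.2 ∂(μ : Measure (Y × U)) := by
    rw [ProbabilityMeasure.toMeasure_map,
      integral_map hmeas.aemeasurable φ.continuous.aestronglyMeasurable]
    simp only [hφ]
  simpa only [hint] using ProbabilityMeasure.tendsto_iff_forall_integral_tendsto.1 hlaw φ
end
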